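/- arXiv:2301.09036 — 2 statements merged into one kernel-verified Lean document; each statement's English description precedes it below -/
import Mathlib

section
/- Let G be a finite simple 3-regular bipartite graph on exactly 2h+8 vertices (h a natural number) having exactly six cycles of length 4, any two distinct 4-cycles of G sharing at most one edge. Then 480·M(G,6) = 486h⁶ − 486h⁵ − 2970h⁴ + 12150h³ − 33996h² − 5904h − 7680 + 80·N(P₅+K₂) (i.e. M(G,6) = (81/80)h⁶ − (81/80)h⁵ − (99/16)h⁴ + (405/16)h³ − (2833/40)h² − (123/10)h − 16 + N(P₅+K₂)/6). -/
open SimpleGraph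

/-- The number of `k`-matchings of a graph `G`: `k`-element sets of pairwise disjoint
edges of `G`, identified with the matching subgraphs of `G` having exactly `k` edges. -/
noncomputable def numMatchings {V : Type*} (G : SimpleGraph V) (k : ℕ) : ℕ :=
  Set.ncard {H : G.Subgraph | H.IsMatching ∧ H.edgeSet.ncard = k}

/-- The number of subgraphs of `G` isomorphic to the graph `X`. -/
noncomputable def numSubgraphs {V W : Type*} (G : SimpleGraph V) (X : SimpleGraph W) : ℕ :=
  Set.ncard {H : G.Subgraph | Nonempty (H.coe ≃g X)}

section Matchings

variable {V : Type*} [Fintype V] (G : SimpleGraph V) [DecidableRel G.Adj]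

open Classical in
/-- The `k`-element sets of pairwise disjoint edges of `G` that avoid the vertices in `S`. -/
noncomputable def matchingsAvoiding (k : ℕ) (S : Finset V) : Finset (Finset (Sym2 V)) :=
  (G.edgeFinset.powersetCard k).filter fun M ↦
    (∀ e ∈ M, ∀ f ∈ M, ∀ v, v ∈ e → v ∈ f → e = f) ∧ ∀ e ∈ M, ∀ v ∈ e, v ∉ S

variable {G}

lemma mem_matchingsAvoiding {k : ℕ} {S : Finset V} {M : Finset (Sym2 V)} :
    M ∈ matchingsAvoiding G k S ↔ ((∀ e ∈ M, e ∈ G.edgeSet) ∧ M.card = k) ∧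
      (∀ e ∈ M, ∀ f ∈ M, ∀ v, v ∈ e → v ∈ f → e = f) ∧ ∀ e ∈ M, ∀ v ∈ e, v ∉ S := by
  simp [matchingsAvoiding, Finset.subset_iff]

lemma card_matchingsAvoiding_zero (S : Finset V) : (matchingsAvoiding G 0 S).card = 1 := by
  rw [Finset.card_eq_one]
  refine ⟨∅, ?_⟩
  ext M
  rw [mem_matchingsAvoiding]
  simp only [Finset.card_eq_zero, Finset.mem_singleton]
  constructor
  · rintro ⟨⟨_, h⟩, _⟩
    exact h
  · rintro rfl
    simp

lemma numMatchings_eq_card_matchingsAvoiding (k : ℕ) :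
    numMatchings G k = (matchingsAvoiding G k ∅).card := by
  classical
  rw [numMatchings, ← Set.ncard_coe_finset]
  refine Set.ncard_congr (fun H _ ↦ H.edgeSet.toFinset) ?_ ?_ ?_
  · rintro H ⟨hH, hk⟩
    rw [Finset.mem_coe, mem_matchingsAvoiding]
    refine ⟨⟨fun e he ↦ H.edgeSet_subset (by simpa using he), ?_⟩, ?_, by simp⟩
    · rw [← hk, Set.ncard_eq_toFinset_card']
    · intro e he f hf v hve hvf
      obtain ⟨a, rfl⟩ := hve
      obtain ⟨b, rfl⟩ := hvf
      simp only [Set.mem_toFinset, Subgraph.mem_edgeSet] at he hf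
      rw [hH.eq_of_adj_left he hf]
  · rintro H H' ⟨hH, _⟩ ⟨hH', _⟩ h
    exact Subgraph.IsMatching.injOn_edgeSet hH hH' (by simpa using h)
  · intro M hM
    rw [Finset.mem_coe, mem_matchingsAvoiding] at hM
    obtain ⟨⟨h1, h2⟩, h3, -⟩ := hM
    let H : G.Subgraph :=
      { verts := {v | ∃ e ∈ M, v ∈ e}
        Adj := fun a b ↦ s(a, b) ∈ M
        adj_sub := fun {a b} h ↦ by simpa using h1 _ h
        edge_vert := fun {a b} h ↦ ⟨_, h, by simp⟩
        symm := ⟨fun a b h ↦ by rwa [Sym2.eq_swap]⟩ }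
    have hH : H.edgeSet = M := by
      ext e
      induction e using Sym2.ind
      simp [H]
    refine ⟨H, ⟨?_, ?_⟩, ?_⟩
    · rintro v ⟨e, he, w, rfl⟩
      refine ⟨w, he, fun w' hw' ↦ ?_⟩
      exact (Sym2.congr_right.1 (h3 _ he _ hw' v (by simp) (by simp))).symm
    · rw [hH, Set.ncard_coe_finset, h2]
    · simp [hH]

variable [DecidableEq V]

/-- Matchings through a given edge correspond to smaller matchings avoiding its endpoints. -/
lemma card_matchingsAvoiding_filter_mem {k : ℕ} {S : Finset V} {v w : V} (hvw : G.Adj v w)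
    (hv : v ∉ S) (hw : w ∉ S) :
    ((matchingsAvoiding G (k + 1) S).filter (s(v, w) ∈ ·)).card =
      (matchingsAvoiding G k (insert w (insert v S))).card := by
  refine Finset.card_bij' (fun M _ ↦ M.erase s(v, w)) (fun M _ ↦ insert s(v, w) M) ?_ ?_ ?_ ?_
  · intro M hM
    rw [Finset.mem_filter, mem_matchingsAvoiding] at hM
    obtain ⟨⟨⟨h1, h2⟩, h3, h4⟩, h5⟩ := hM
    rw [mem_matchingsAvoiding]
    refine ⟨⟨fun e he ↦ h1 e (Finset.mem_of_mem_erase he), ?_⟩,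
      fun e he f hf ↦ h3 e (Finset.mem_of_mem_erase he) f (Finset.mem_of_mem_erase hf), ?_⟩
    · rw [Finset.card_erase_of_mem h5, h2]
      rfl
    · intro e he x hx hxS
      rw [Finset.mem_insert, Finset.mem_insert] at hxS
      rw [Finset.mem_erase] at he
      rcases hxS with rfl | rfl | hxS
      · exact he.1 (h3 e he.2 _ h5 x hx (by simp))
      · exact he.1 (h3 e he.2 _ h5 x hx (by simp))
      · exact h4 e he.2 x hx hxS
  · intro M hM
    rw [mem_matchingsAvoiding] at hM
    obtain ⟨⟨h1, h2⟩, h3, h4⟩ := hM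
    have h5 : ∀ e ∈ M, v ∉ e ∧ w ∉ e := fun e he ↦
      ⟨fun h ↦ h4 e he v h (by simp), fun h ↦ h4 e he w h (by simp)⟩
    have h6 : s(v, w) ∉ M := fun h ↦ (h5 _ h).1 (by simp)
    rw [Finset.mem_filter, mem_matchingsAvoiding]
    refine ⟨⟨⟨?_, ?_⟩, ?_, ?_⟩, by simp⟩
    · intro e he
      rcases Finset.mem_insert.1 he with rfl | he
      · simpa using hvw
      · exact h1 e he
    · rw [Finset.card_insert_of_notMem h6, h2]
    · intro e he f hf x hx hx'
      rcases Finset.mem_insert.1 he with rfl | he' <;> rcases Finset.mem_insert.1 hf with rfl | hf'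
      · rfl
      · rcases Sym2.mem_iff.1 hx with rfl | rfl
        · exact absurd hx' (h5 f hf').1
        · exact absurd hx' (h5 f hf').2
      · rcases Sym2.mem_iff.1 hx' with rfl | rfl
        · exact absurd hx (h5 e he').1
        · exact absurd hx (h5 e he').2
      · exact h3 e he' f hf' x hx hx'
    · intro e he x hx
      rcases Finset.mem_insert.1 he with rfl | he
      · rcases Sym2.mem_iff.1 hx with rfl | rfl <;> assumption
      · intro hxS
        exact h4 e he x hx (by simp [hxS])
  · intro M hM
    exact Finset.insert_erase (Finset.mem_filter.1 hM).2
  · intro M hM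
    refine Finset.erase_insert fun h ↦ ?_
    exact (mem_matchingsAvoiding.1 hM).2.2 _ h v (by simp) (by simp)

/-- Split matchings according to the partner of the vertex `v`. -/
lemma card_matchingsAvoiding_succ {k : ℕ} {S : Finset V} {v : V} (hv : v ∉ S) :
    (matchingsAvoiding G (k + 1) S).card = (matchingsAvoiding G (k + 1) (insert v S)).card +
      ∑ w ∈ G.neighborFinset v \ S, (matchingsAvoiding G k (insert w (insert v S))).card := by
  rw [← Finset.card_filter_add_card_filter_not (s := matchingsAvoiding G (k + 1) S)
    (fun M ↦ ∀ e ∈ M, v ∉ e)]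
  congr 1
  · congr 1
    ext M
    simp only [Finset.mem_filter, mem_matchingsAvoiding, Finset.mem_insert]
    constructor
    · rintro ⟨⟨h1, h3, h4⟩, h5⟩
      refine ⟨h1, h3, fun e he x hx hxS ↦ ?_⟩
      rcases hxS with rfl | hxS
      · exact h5 e he hx
      · exact h4 e he x hx hxS
    · rintro ⟨h1, h3, h4⟩
      exact ⟨⟨h1, h3, fun e he x hx hxS ↦ h4 e he x hx (.inr hxS)⟩,
        fun e he hv ↦ h4 e he v hv (.inl rfl)⟩
  · have : (matchingsAvoiding G (k + 1) S).filter (fun M ↦ ¬ ∀ e ∈ M, v ∉ e) =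
        (G.neighborFinset v \ S).biUnion
          fun w ↦ (matchingsAvoiding G (k + 1) S).filter (s(v, w) ∈ ·) := by
      ext M
      simp only [Finset.mem_filter, Finset.mem_biUnion, Finset.mem_sdiff, mem_neighborFinset]
      constructor
      · rintro ⟨hM, h⟩
        push Not at h
        obtain ⟨e, he, hve⟩ := h
        obtain ⟨w, rfl⟩ := hve
        have := mem_matchingsAvoiding.1 hM
        exact ⟨w, ⟨by simpa using this.1.1 _ he, this.2.2 _ he w (by simp)⟩, hM, he⟩
      · rintro ⟨w, _, hM, he⟩
        exact ⟨hM, fun h ↦ h _ he (by simp)⟩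
    rw [this, Finset.card_biUnion]
    · refine Finset.sum_congr rfl fun w hw ↦ ?_
      rw [Finset.mem_sdiff, mem_neighborFinset] at hw
      exact card_matchingsAvoiding_filter_mem hw.1 hv hw.2
    · intro w _ w' _ hne
      rw [Function.onFun, Finset.disjoint_left]
      intro M hM hM'
      rw [Finset.mem_filter] at hM hM'
      have := (mem_matchingsAvoiding.1 hM.1).2.1 _ hM.2 _ hM'.2 v (by simp) (by simp)
      exact hne (Sym2.congr_right.1 this)

/-- Double counting of matchings and uncovered vertices. -/
lemma sum_card_matchingsAvoiding_insert (k : ℕ) (S : Finset V) :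
    ∑ v ∈ Sᶜ, (matchingsAvoiding G k (insert v S)).card +
      (S.card + 2 * k) * (matchingsAvoiding G k S).card =
        Fintype.card V * (matchingsAvoiding G k S).card := by
  have h1 : ∀ v, matchingsAvoiding G k (insert v S) =
      (matchingsAvoiding G k S).filter (fun M ↦ ∀ e ∈ M, v ∉ e) := by
    intro v
    ext M
    simp only [Finset.mem_filter, mem_matchingsAvoiding, Finset.mem_insert]
    grind
  simp_rw [h1, Finset.card_filter]
  rw [Finset.sum_comm]
  simp_rw [← Finset.card_filter]
  have h2 : ∀ M ∈ matchingsAvoiding G k S,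
      (Sᶜ.filter (fun v ↦ ∀ e ∈ M, v ∉ e)).card + (S.card + 2 * k) = Fintype.card V := by
    intro M hM
    obtain ⟨⟨h1, h2⟩, h3, h4⟩ := mem_matchingsAvoiding.1 hM
    have h5 : (M.biUnion Sym2.toFinset).card = 2 * k := by
      rw [Finset.card_biUnion]
      · rw [Finset.sum_congr rfl fun e he ↦
          Sym2.card_toFinset_of_not_isDiag e (G.not_isDiag_of_mem_edgeSet (h1 e he))]
        simp [h2, mul_comm]
      · intro e he f hf hne
        rw [Function.onFun, Finset.disjoint_left]
        intro x hx hx'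
        exact hne (h3 e he f hf x (by simpa using hx) (by simpa using hx'))
    have h6 : Sᶜ.filter (fun v ↦ ∀ e ∈ M, v ∉ e) = (S ∪ M.biUnion Sym2.toFinset)ᶜ := by
      ext x
      simp
    have h7 : Disjoint S (M.biUnion Sym2.toFinset) := by
      rw [Finset.disjoint_right]
      intro x hx
      simp only [Finset.mem_biUnion, Sym2.mem_toFinset] at hx
      obtain ⟨e, he, hx⟩ := hx
      exact h4 e he x hx
    rw [h6, ← h5, ← Finset.card_union_of_disjoint h7, Finset.card_compl_add_card]
  rw [← smul_eq_mul (a := Fintype.card V), mul_comm, ← smul_eq_mul, ← smul_eq_mul,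
    smul_eq_mul, smul_eq_mul, smul_eq_mul, mul_comm (Fintype.card V),
    ← Finset.sum_const_nat h2, Finset.sum_add_distrib]
  simp

end Matchings

section Copies

variable {V W : Type*}

/-- An injective endomorphism of a finite graph is an automorphism. -/
lemma card_iso_self_eq_card_copy [Finite W] (X : SimpleGraph W) :
    Nat.card (X ≃g X) = Nat.card (Copy X X) := by
  refine Nat.card_eq_of_bijective (fun e ↦ e.toCopy) ⟨?_, ?_⟩
  · intro e e' h
    ext x
    exact congrArg (fun f : Copy X X ↦ f x) h
  · intro f
    have hb : Function.Bijective f.toHom := Finite.injective_iff_bijective.1 f.injective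
    have hs : Function.Surjective f.toHom.mapEdgeSet :=
      Finite.injective_iff_surjective.1 (Hom.mapEdgeSet.injective _ f.injective)
    refine ⟨⟨Equiv.ofBijective _ hb, ?_⟩, ?_⟩
    · intro a b
      refine ⟨fun h ↦ ?_, fun h ↦ f.toHom.map_adj h⟩
      obtain ⟨⟨e, he⟩, h'⟩ := hs ⟨s(f.toHom a, f.toHom b), h⟩
      have h2 : Sym2.map f.toHom e = Sym2.map f.toHom s(a, b) := congrArg Subtype.val h'
      have := Sym2.map.injective f.injective h2
      subst this
      exact he
    · ext x
      rfl

/-- Labelled copies of `X` are subgraphs isomorphic to `X` with a choice of isomorphism. -/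
lemma card_copy_eq_numSubgraphs_mul [Finite V] [Finite W] (G : SimpleGraph V)
    (X : SimpleGraph W) :
    Nat.card (Copy X G) = numSubgraphs G X * Nat.card (Copy X X) := by
  classical
  have : Finite (Copy X G) := Finite.of_injective _ (DFunLike.coe_injective (F := Copy X G))
  have := Fintype.ofFinite (Copy X G)
  have : Finite (G.Subgraph) := inferInstance
  have := Fintype.ofFinite G.Subgraph
  rw [← card_iso_self_eq_card_copy, numSubgraphs, Nat.card_eq_fintype_card,
    Set.ncard_eq_toFinset_card', ← Finset.card_univ]
  rw [Finset.card_eq_sum_card_fiberwise (f := Copy.toSubgraph)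
    (t := {H : G.Subgraph | Nonempty (H.coe ≃g X)}.toFinset)]
  · rw [← smul_eq_mul, ← Finset.sum_const]
    refine Finset.sum_congr rfl fun H hH ↦ ?_
    simp only [Set.mem_toFinset, Set.mem_ofPred_eq] at hH
    obtain ⟨e⟩ := hH
    have : Finite (X ≃g X) := Finite.of_injective _ (DFunLike.coe_injective (F := X ≃g X))
    have := Fintype.ofFinite (X ≃g X)
    rw [Nat.card_eq_fintype_card, ← Finset.card_univ]
    symm
    refine Finset.card_bij (fun σ _ ↦ ⟨H.hom.comp (e.symm.toHom.comp σ.toHom),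
      Subgraph.hom_injective.comp (e.symm.injective.comp σ.injective)⟩) ?_ ?_ ?_
    · intro σ _
      simp [Copy.toSubgraph, Subgraph.map_comp]
    · intro σ _ τ _ h
      ext x
      have h1 := congrArg (fun f : Copy X G ↦ f x) h
      exact e.symm.injective (Subgraph.hom_injective h1)
    · intro f hf
      obtain rfl : f.toSubgraph = H := by simpa using hf
      refine ⟨f.isoToSubgraph.trans e, Finset.mem_univ _, ?_⟩
      ext x
      change ((e.symm (e (f.isoToSubgraph x)) : f.toSubgraph.verts) : V) = f x
      rw [RelIso.symm_apply_apply]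
      rfl
  · intro f _
    simpa using ⟨f.isoToSubgraph.symm⟩

end Copies

section TwoColoring

variable {V : Type*} {G : SimpleGraph V}

lemma not_adj_of_adj_of_adj {col : V → Bool} (hcol : ∀ ⦃a b⦄, G.Adj a b → col a ≠ col b)
    {a b c : V} (hab : G.Adj a b) (hbc : G.Adj b c) : ¬ G.Adj c a := by
  intro hca
  have h1 := hcol hab
  have h2 := hcol hbc
  have h3 := hcol hca
  revert h1 h2 h3
  cases col a <;> cases col b <;> cases col c <;> simp

lemma not_adj_of_adj_of_adj_of_adj_of_adj {col : V → Bool}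
    (hcol : ∀ ⦃a b⦄, G.Adj a b → col a ≠ col b) {a b c d e : V} (hab : G.Adj a b)
    (hbc : G.Adj b c) (hcd : G.Adj c d) (hde : G.Adj d e) : ¬ G.Adj e a := by
  intro hea
  have h1 := hcol hab
  have h2 := hcol hbc
  have h3 := hcol hcd
  have h4 := hcol hde
  have h5 := hcol hea
  revert h1 h2 h3 h4 h5
  cases col a <;> cases col b <;> cases col c <;> cases col d <;> cases col e <;> simp

end TwoColoring

section PathSums

variable {V : Type*} [Fintype V] [DecidableEq V] (G : SimpleGraph V) [DecidableRel G.Adj]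

/-- The sum of `f u T` over all paths with `j` edges that start at `v` and avoid `S`, where `u` is
the last vertex of the path and `T` consists of `S` and the other vertices of the path. -/
def pathSum (f : V → Finset V → ℕ) : ℕ → V → Finset V → ℕ
  | 0, v, S => f v S
  | j + 1, v, S => ∑ w ∈ G.neighborFinset v \ S, pathSum f j w (insert v S)

/-- The number of pairs of a vertex sequence of a path with `j` edges and a disjoint
`k`-matching. -/
noncomputable def pathMatchingCount (j k : ℕ) : ℕ :=
  ∑ v, pathSum G (fun u T ↦ (matchingsAvoiding G k (insert u T)).card) j v ∅

/-- The number of pairs of a `k`-matching and a vertex sequence of a path with `j` edges all of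
whose vertices except possibly the last one avoid the matching. -/
noncomputable def openPathMatchingCount (j k : ℕ) : ℕ :=
  ∑ v, pathSum G (fun _ T ↦ (matchingsAvoiding G k T).card) j v ∅

variable {G}

lemma pathSum_succ (f : V → Finset V → ℕ) (j : ℕ) (v : V) (S : Finset V) :
    pathSum G f (j + 1) v S = ∑ w ∈ G.neighborFinset v \ S, pathSum G f j w (insert v S) :=
  rfl

lemma pathSum_matchingsAvoiding_succ (k j : ℕ) (v : V) (S : Finset V) (hv : v ∉ S) :
    pathSum G (fun _ T ↦ (matchingsAvoiding G (k + 1) T).card) j v S =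
      pathSum G (fun u T ↦ (matchingsAvoiding G (k + 1) (insert u T)).card) j v S +
        pathSum G (fun u T ↦ (matchingsAvoiding G k (insert u T)).card) (j + 1) v S := by
  induction j generalizing v S with
  | zero => exact card_matchingsAvoiding_succ hv
  | succ j ih =>
    rw [pathSum_succ, pathSum_succ, pathSum_succ _ (j + 1), ← Finset.sum_add_distrib]
    refine Finset.sum_congr rfl fun w hw ↦ ih w _ ?_
    rw [Finset.mem_sdiff, mem_neighborFinset] at hw
    simp [hw.2, hw.1.ne']

lemma openPathMatchingCount_succ (j k : ℕ) : openPathMatchingCount G j (k + 1) =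
    pathMatchingCount G j (k + 1) + pathMatchingCount G (j + 1) k := by
  simp_rw [openPathMatchingCount, pathMatchingCount, ← Finset.sum_add_distrib]
  exact Finset.sum_congr rfl fun v _ ↦ pathSum_matchingsAvoiding_succ k j v ∅ (by simp)

lemma openPathMatchingCount_zero_right (j : ℕ) :
    openPathMatchingCount G j 0 = pathMatchingCount G j 0 := by
  simp [openPathMatchingCount, pathMatchingCount, card_matchingsAvoiding_zero]

lemma pathMatchingCount_zero (k : ℕ) :
    pathMatchingCount G 0 k + 2 * k * (matchingsAvoiding G k ∅).card =
      Fintype.card V * (matchingsAvoiding G k ∅).card := by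
  simpa [pathMatchingCount, pathSum] using sum_card_matchingsAvoiding_insert (G := G) k ∅

lemma openPathMatchingCount_zero (k : ℕ) :
    openPathMatchingCount G 0 k = Fintype.card V * (matchingsAvoiding G k ∅).card := by
  simp [openPathMatchingCount, pathSum]

/-- Count matchings with a distinguished edge and orientation of that edge. -/
lemma two_mul_card_matchingsAvoiding_succ (k : ℕ) (S : Finset V) :
    2 * (k + 1) * (matchingsAvoiding G (k + 1) S).card =
      ∑ v ∈ Sᶜ, ∑ w ∈ G.neighborFinset v \ S,
        (matchingsAvoiding G k (insert w (insert v S))).card := by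
  have h1 := sum_card_matchingsAvoiding_insert (G := G) (k + 1) S
  have h2 : ∑ v ∈ Sᶜ, (matchingsAvoiding G (k + 1) S).card = _ :=
    Finset.sum_congr rfl fun v hv ↦
      card_matchingsAvoiding_succ (G := G) (k := k) (Finset.mem_compl.1 hv)
  rw [Finset.sum_add_distrib, Finset.sum_const, smul_eq_mul] at h2
  rw [← S.card_add_card_compl] at h1
  linarith

lemma two_mul_card_matchingsAvoiding_one (S : Finset V) :
    2 * (matchingsAvoiding G 1 S).card = ∑ v ∈ Sᶜ, (G.neighborFinset v \ S).card := by
  simpa [card_matchingsAvoiding_zero] using two_mul_card_matchingsAvoiding_succ (G := G) 0 S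

lemma card_neighborFinset_sdiff_add (v : V) (S : Finset V) :
    (G.neighborFinset v \ S).card + (S.filter (G.Adj v)).card = G.degree v := by
  have h : S.filter (G.Adj v) = G.neighborFinset v ∩ S := by
    ext
    simp [and_comm]
  rw [h, Finset.card_sdiff_add_card_inter, card_neighborFinset_eq_degree]

variable (G) in
/-- The number of 4-cycles with a distinguished start and orientation. -/
def fourCycleCount : ℕ :=
  ∑ v, ∑ w ∈ G.neighborFinset v, ∑ x ∈ G.neighborFinset w \ {v},
    ∑ y ∈ G.neighborFinset x \ {w, v}, if G.Adj y v then 1 else 0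

section Cubic

variable (hreg : G.IsRegularOfDegree 3)
include hreg

lemma openPathMatchingCount_one (k : ℕ) :
    openPathMatchingCount G 1 k = 3 * pathMatchingCount G 0 k := by
  simp only [openPathMatchingCount, pathMatchingCount, pathSum, Finset.mul_sum]
  refine Finset.sum_congr rfl fun v _ ↦ ?_
  simp [hreg.degree_eq v]

lemma openPathMatchingCount_two (k : ℕ) :
    openPathMatchingCount G 2 k = 2 * pathMatchingCount G 1 k := by
  simp only [openPathMatchingCount, pathMatchingCount, pathSum, Finset.mul_sum]
  refine Finset.sum_congr rfl fun v _ ↦ Finset.sum_congr rfl fun w hw ↦ ?_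
  simp only [Finset.mem_sdiff, mem_neighborFinset] at hw
  have h := card_neighborFinset_sdiff_add (G := G) w (insert v ∅)
  simp only [Finset.filter_insert, Finset.filter_empty, hw.1.symm, if_true, hreg.degree_eq] at h
  rw [Finset.sum_const, smul_eq_mul]
  congr 1
  simpa using h

variable {col : V → Bool} (hcol : ∀ ⦃a b⦄, G.Adj a b → col a ≠ col b)
include hcol

lemma openPathMatchingCount_three (k : ℕ) :
    openPathMatchingCount G 3 k = 2 * pathMatchingCount G 2 k := by
  simp only [openPathMatchingCount, pathMatchingCount, pathSum, Finset.mul_sum]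
  refine Finset.sum_congr rfl fun v _ ↦ Finset.sum_congr rfl fun w hw ↦
    Finset.sum_congr rfl fun x hx ↦ ?_
  simp only [Finset.mem_sdiff, mem_neighborFinset] at hw hx
  have h := card_neighborFinset_sdiff_add (G := G) x (insert w (insert v ∅))
  have h1 : ¬ G.Adj x v := not_adj_of_adj_of_adj hcol (by simpa using hw.1) hx.1
  simp only [Finset.filter_insert, Finset.filter_empty, hx.1.symm, h1, if_true, if_false,
    hreg.degree_eq] at h
  rw [Finset.sum_const, smul_eq_mul]
  congr 1
  simpa using h

lemma openPathMatchingCount_four {k m : ℕ}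
    (hm : ∀ v w x y, G.Adj v w → G.Adj w x → G.Adj x y → G.Adj y v → x ≠ v → y ≠ w →
      (matchingsAvoiding G k {y, x, w, v}).card = m) :
    openPathMatchingCount G 4 k + m * fourCycleCount G = 2 * pathMatchingCount G 3 k := by
  simp only [openPathMatchingCount, pathMatchingCount, pathSum, Finset.mul_sum, fourCycleCount,
    ← Finset.sum_add_distrib, insert_empty_eq, Finset.sdiff_empty]
  refine Finset.sum_congr rfl fun v _ ↦ Finset.sum_congr rfl fun w hw ↦
    Finset.sum_congr rfl fun x hx ↦ Finset.sum_congr rfl fun y hy ↦ ?_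
  simp only [Finset.mem_sdiff, mem_neighborFinset, Finset.mem_insert, Finset.mem_singleton,
    not_or] at hw hx hy
  have h := card_neighborFinset_sdiff_add (G := G) y {x, w, v}
  have h1 : ¬ G.Adj y w := not_adj_of_adj_of_adj hcol hx.1 hy.1
  rw [Finset.sum_const, smul_eq_mul]
  by_cases h2 : G.Adj y v
  · rw [if_pos h2, hm v w x y hw hx.1 hy.1 h2 hx.2 hy.2.1]
    have hne : x ≠ v := hx.2
    simp only [Finset.filter_insert, Finset.filter_singleton, hy.1.symm, h1, h2, if_true, if_false,
      hreg.degree_eq, Finset.card_pair hne] at h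
    have h3 : (G.neighborFinset y \ {x, w, v}).card = 1 := by omega
    rw [h3]
    ring
  · simp only [Finset.filter_insert, Finset.filter_singleton, hy.1.symm, h1, h2, if_true, if_false,
      hreg.degree_eq] at h
    rw [if_neg h2, mul_zero, add_zero]
    congr 1
    simpa using h

lemma openPathMatchingCount_five :
    openPathMatchingCount G 5 0 + fourCycleCount G = 2 * pathMatchingCount G 4 0 := by
  have h : fourCycleCount G = ∑ v, ∑ w ∈ G.neighborFinset v, ∑ x ∈ G.neighborFinset w \ {v},
      ∑ y ∈ G.neighborFinset x \ {w, v}, ∑ z ∈ G.neighborFinset y \ {x, w, v},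
        if G.Adj z w then 1 else 0 := by
    symm
    calc
      _ = ∑ w, ∑ v ∈ G.neighborFinset w, ∑ x ∈ G.neighborFinset w \ {v},
          ∑ y ∈ G.neighborFinset x \ {w, v}, ∑ z ∈ G.neighborFinset y \ {x, w, v},
            if G.Adj z w then 1 else 0 :=
        Finset.sum_comm' fun a b ↦ by simp [adj_comm]
      _ = ∑ w, ∑ x ∈ G.neighborFinset w, ∑ y ∈ G.neighborFinset x \ {w},
          ∑ z ∈ G.neighborFinset y \ {x, w}, if G.Adj z w then 1 else 0 := by
        refine Finset.sum_congr rfl fun w _ ↦ ?_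
        rw [Finset.sum_comm' (t' := G.neighborFinset w) (s' := fun x ↦ G.neighborFinset w \ {x})
          (by simp; grind)]
        refine Finset.sum_congr rfl fun x hx ↦ ?_
        rw [Finset.sum_comm' (t' := G.neighborFinset x \ {w})
          (s' := fun y ↦ G.neighborFinset w \ {x, y}) (by simp; grind)]
        refine Finset.sum_congr rfl fun y hy ↦ ?_
        rw [Finset.sum_comm' (t' := G.neighborFinset y \ {x, w})
          (s' := fun z ↦ G.neighborFinset w \ {x, y, z}) (by simp; grind)]
        refine Finset.sum_congr rfl fun z hz ↦ ?_
        simp only [Finset.mem_sdiff, mem_neighborFinset, Finset.mem_insert, Finset.mem_singleton,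
          not_or] at hx hy hz
        split_ifs with hzw
        · have h := card_neighborFinset_sdiff_add (G := G) w {x, y, z}
          have h1 : ¬ G.Adj w y := fun h ↦ not_adj_of_adj_of_adj hcol hx hy.1 h.symm
          simp only [Finset.filter_insert, Finset.filter_singleton, hx, h1, hzw.symm, if_true,
            if_false, hreg.degree_eq, Finset.card_pair (Ne.symm hz.2.1)] at h
          simp only [Finset.sum_const, smul_eq_mul]
          omega
        · simp
  rw [h]
  simp only [openPathMatchingCount, pathMatchingCount, pathSum, Finset.mul_sum,
    ← Finset.sum_add_distrib, insert_empty_eq, Finset.sdiff_empty, card_matchingsAvoiding_zero]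
  refine Finset.sum_congr rfl fun v _ ↦ Finset.sum_congr rfl fun w hw ↦
    Finset.sum_congr rfl fun x hx ↦ Finset.sum_congr rfl fun y hy ↦
    Finset.sum_congr rfl fun z hz ↦ ?_
  simp only [Finset.mem_sdiff, mem_neighborFinset, Finset.mem_insert, Finset.mem_singleton,
    not_or] at hw hx hy hz
  have h := card_neighborFinset_sdiff_add (G := G) z {y, x, w, v}
  have h1 : ¬ G.Adj z x := not_adj_of_adj_of_adj hcol hy.1 hz.1
  have h2 : ¬ G.Adj z v := not_adj_of_adj_of_adj_of_adj_of_adj hcol hw hx.1 hy.1 hz.1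
  rw [Finset.sum_const, smul_eq_mul]
  by_cases h3 : G.Adj z w
  · simp only [Finset.filter_insert, Finset.filter_singleton, hz.1.symm, h1, h2, h3, if_true,
      if_false, hreg.degree_eq, insert_empty_eq, Finset.card_pair hy.2.1] at h
    rw [if_pos h3]
    omega
  · simp only [Finset.filter_insert, Finset.filter_singleton, hz.1.symm, h1, h2, h3, if_true,
      if_false, hreg.degree_eq, insert_empty_eq, Finset.card_singleton] at h
    rw [if_neg h3]
    omega

end Cubic

end PathSums

section FourCycles

variable {V : Type*} {G : SimpleGraph V}

lemma exists_copy_cycleGraph_four {a b c d : V} (hab : G.Adj a b) (hbc : G.Adj b c)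
    (hcd : G.Adj c d) (hda : G.Adj d a) (hca : c ≠ a) (hdb : d ≠ b) :
    ∃ f : Copy (cycleGraph 4) G, ⇑f = ![a, b, c, d] := by
  refine ⟨⟨⟨![a, b, c, d], ?_⟩, ?_⟩, rfl⟩
  · intro i j hij
    fin_cases i <;> fin_cases j <;> first
      | exact absurd hij (by decide)
      | simp [hab, hbc, hcd, hda, hab.symm, hbc.symm, hcd.symm, hda.symm]
  · intro i j hij
    fin_cases i <;> fin_cases j <;>
      simp_all [hab.ne, hbc.ne, hcd.ne, hda.ne, hab.ne', hbc.ne', hcd.ne', hda.ne', hca.symm,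
        hdb.symm]

/-- If distinct 4-cycles share at most one edge, then two vertices have at most two common
neighbours. -/
lemma false_of_common_neighbors [Finite V]
    (hshare : ∀ H₁ H₂ : G.Subgraph, Nonempty (H₁.coe ≃g cycleGraph 4) →
      Nonempty (H₂.coe ≃g cycleGraph 4) → H₁ ≠ H₂ →
      (H₁.edgeSet ∩ H₂.edgeSet).ncard ≤ 1)
    {a b x y z : V} (hab : a ≠ b) (hxy : x ≠ y) (hxz : x ≠ z) (hyz : y ≠ z)
    (hax : G.Adj a x) (hay : G.Adj a y) (haz : G.Adj a z)
    (hbx : G.Adj b x) (hby : G.Adj b y) (hbz : G.Adj b z) : False := by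
  obtain ⟨f, hf⟩ := exists_copy_cycleGraph_four hax hbx.symm hby hay.symm hab.symm hxy.symm
  obtain ⟨g, hg⟩ := exists_copy_cycleGraph_four hax hbx.symm hbz haz.symm hab.symm hxz.symm
  have hedge : ∀ (k : Copy (cycleGraph 4) G) (i j), (cycleGraph 4).Adj i j →
      s(k i, k j) ∈ k.toSubgraph.edgeSet := fun k i j hij ↦
    Subgraph.mem_edgeSet.2 ⟨i, j, hij, rfl, rfl⟩
  have hne : f.toSubgraph ≠ g.toSubgraph := by
    intro h
    have h1 : y ∈ f.toSubgraph.verts := ⟨3, trivial, by change f 3 = y; rw [hf]; rfl⟩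
    rw [h] at h1
    obtain ⟨i, -, hi⟩ := h1
    replace hi : g i = y := hi
    rw [hg] at hi
    fin_cases i
    · exact hay.ne hi
    · exact hxy hi
    · exact hby.ne hi
    · exact hyz hi.symm
  have h := hshare _ _ ⟨f.isoToSubgraph.symm⟩ ⟨g.isoToSubgraph.symm⟩ hne
  rw [Set.ncard_le_one] at h
  have h1 := h
    s(a, x) ⟨by simpa [hf] using hedge f 0 1 (by decide),
      by simpa [hg] using hedge g 0 1 (by decide)⟩
    s(x, b) ⟨by simpa [hf] using hedge f 1 2 (by decide),
      by simpa [hg] using hedge g 1 2 (by decide)⟩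
  rw [Sym2.eq_swap, Sym2.congr_right] at h1
  exact hab h1

lemma card_fourCycle [DecidableEq V] {v w x y : V} (hvw : G.Adj v w) (hwx : G.Adj w x)
    (hxy : G.Adj x y) (hyv : G.Adj y v) (hxv : x ≠ v) (hyw : y ≠ w) :
    ({y, x, w, v} : Finset V).card = 4 := by
  rw [Finset.card_insert_of_notMem, Finset.card_insert_of_notMem, Finset.card_pair hvw.ne']
  · simp [hwx.ne', hxv]
  · simp [hxy.ne', hyw, hyv.ne]

variable [DecidableEq V] [DecidableRel G.Adj]
  {col : V → Bool} (hcol : ∀ ⦃a b⦄, G.Adj a b → col a ≠ col b)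
  (hK : ∀ {a b x y z : V}, a ≠ b → x ≠ y → x ≠ z → y ≠ z → G.Adj a x → G.Adj a y → G.Adj a z →
    G.Adj b x → G.Adj b y → G.Adj b z → False)
  {v w x y : V} (hvw : G.Adj v w) (hwx : G.Adj w x) (hxy : G.Adj x y) (hyv : G.Adj y v)
  (hxv : x ≠ v) (hyw : y ≠ w)

include hcol hK hvw hwx hxy hyv hxv hyw in
lemma card_filter_adj_le_one {u : V} (hu : u ∉ ({y, x, w, v} : Finset V)) :
    (({y, x, w, v} : Finset V).filter (G.Adj u)).card ≤ 1 := by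
  simp only [Finset.mem_insert, Finset.mem_singleton, not_or] at hu
  obtain ⟨huy, hux, huw, huv⟩ := hu
  rw [Finset.card_le_one]
  have key1 : G.Adj u v → G.Adj u w → False := fun h1 h2 ↦
    not_adj_of_adj_of_adj hcol h1 hvw h2.symm
  have key2 : G.Adj u w → G.Adj u x → False := fun h1 h2 ↦
    not_adj_of_adj_of_adj hcol h1 hwx h2.symm
  have key3 : G.Adj u x → G.Adj u y → False := fun h1 h2 ↦
    not_adj_of_adj_of_adj hcol h1 hxy h2.symm
  have key4 : G.Adj u y → G.Adj u v → False := fun h1 h2 ↦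
    not_adj_of_adj_of_adj hcol h1 hyv h2.symm
  have key5 : G.Adj u v → G.Adj u x → False := fun h1 h2 ↦
    hK hxv hyw (Ne.symm huy) (Ne.symm huw) hxy hwx.symm h2.symm hyv.symm hvw h1.symm
  have key6 : G.Adj u w → G.Adj u y → False := fun h1 h2 ↦
    hK hyw hxv (Ne.symm hux) (Ne.symm huv) hxy.symm hyv h2.symm hwx hvw.symm h1.symm
  clear hK hcol
  simp only [Finset.mem_filter, Finset.mem_insert, Finset.mem_singleton]
  rintro a ⟨rfl | rfl | rfl | rfl, ha⟩ b ⟨rfl | rfl | rfl | rfl, hb⟩ <;> tauto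

variable [Fintype V] (hreg : G.IsRegularOfDegree 3)

include hreg hcol hvw hwx hxy hyv hxv hyw in
lemma card_neighborFinset_sdiff_fourCycle {c : V} (hc : c ∈ ({y, x, w, v} : Finset V)) :
    (G.neighborFinset c \ {y, x, w, v}).card = 1 := by
  have h := card_neighborFinset_sdiff_add (G := G) c {y, x, w, v}
  have h1 : ¬ G.Adj v x := fun h ↦ not_adj_of_adj_of_adj hcol hvw hwx h.symm
  have h2 : ¬ G.Adj w y := fun h ↦ not_adj_of_adj_of_adj hcol hwx hxy h.symm
  simp only [Finset.mem_insert, Finset.mem_singleton] at hc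
  have h1' : ¬ G.Adj x v := fun h ↦ h1 (G.adj_symm h)
  have h2' : ¬ G.Adj y w := fun h ↦ h2 (G.adj_symm h)
  rcases hc with rfl | rfl | rfl | rfl <;>
  simp only [Finset.filter_insert, Finset.filter_singleton, hvw, hwx, hxy, hyv, hvw.symm, hwx.symm,
    hxy.symm, hyv.symm, h1, h2, h1', h2', if_true, if_false, G.irrefl, hreg.degree_eq,
    insert_empty_eq, Finset.card_pair hxv, Finset.card_pair hyw] at h <;> omega

include hreg hcol hvw hwx hxy hyv hxv hyw in
lemma sum_card_filter_fourCycle :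
    ∑ u ∈ ({y, x, w, v} : Finset V)ᶜ, (({y, x, w, v} : Finset V).filter (G.Adj u)).card = 4 := by
  have h := Finset.sum_card_bipartiteAbove_eq_sum_card_bipartiteBelow
    (s := ({y, x, w, v} : Finset V)ᶜ) (t := {y, x, w, v}) G.Adj
  refine h.trans ?_
  rw [← card_fourCycle hvw hwx hxy hyv hxv hyw, Finset.card_eq_sum_ones]
  refine Finset.sum_congr rfl fun c hc ↦ ?_
  rw [← card_neighborFinset_sdiff_fourCycle hcol hvw hwx hxy hyv hxv hyw hreg hc]
  congr 1
  ext u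
  simp [Finset.bipartiteBelow, G.adj_comm u, and_comm]

include hreg hcol hK hvw hwx hxy hyv hxv hyw in
/-- Power sums of the degrees in the subgraph obtained by deleting a 4-cycle. -/
lemma sum_card_sdiff_fourCycle {h : ℕ} (hcard : Fintype.card V = 2 * h + 8) :
    ∑ u ∈ ({y, x, w, v} : Finset V)ᶜ, (G.neighborFinset u \ {y, x, w, v}).card = 6 * h + 8 ∧
    ∑ u ∈ ({y, x, w, v} : Finset V)ᶜ, (G.neighborFinset u \ {y, x, w, v}).card ^ 2 =
      18 * h + 16 := by
  have h1 := sum_card_filter_fourCycle hcol hvw hwx hxy hyv hxv hyw hreg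
  have h2 : ({y, x, w, v} : Finset V)ᶜ.card = 2 * h + 4 := by
    rw [Finset.card_compl, card_fourCycle hvw hwx hxy hyv hxv hyw, hcard]
    omega
  have h3 : ∀ u ∈ ({y, x, w, v} : Finset V)ᶜ, (G.neighborFinset u \ {y, x, w, v}).card +
      (({y, x, w, v} : Finset V).filter (G.Adj u)).card = 3 := fun u _ ↦ by
    rw [card_neighborFinset_sdiff_add, hreg.degree_eq]
  have h4 : ∀ u ∈ ({y, x, w, v} : Finset V)ᶜ, (G.neighborFinset u \ {y, x, w, v}).card ^ 2 +
      5 * (({y, x, w, v} : Finset V).filter (G.Adj u)).card = 9 := fun u hu ↦ by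
    have h5 := card_filter_adj_le_one hcol hK hvw hwx hxy hyv hxv hyw (Finset.mem_compl.1 hu)
    have h6 := h3 u hu
    obtain h7 | h7 := Nat.le_one_iff_eq_zero_or_eq_one.1 h5
    · rw [h7] at h6 ⊢
      norm_num [show (G.neighborFinset u \ {y, x, w, v}).card = 3 by omega]
    · rw [h7] at h6 ⊢
      norm_num [show (G.neighborFinset u \ {y, x, w, v}).card = 2 by omega]
  have h5 := Finset.sum_congr rfl h3
  have h6 := Finset.sum_congr rfl h4
  rw [Finset.sum_add_distrib, Finset.sum_const, h2, h1, smul_eq_mul] at h5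
  rw [Finset.sum_add_distrib, ← Finset.mul_sum, Finset.sum_const, h2, h1, smul_eq_mul] at h6
  omega

include hreg hcol hK hvw hwx hxy hyv hxv hyw in
lemma card_matchingsAvoiding_one_fourCycle {h : ℕ} (hcard : Fintype.card V = 2 * h + 8) :
    (matchingsAvoiding G 1 {y, x, w, v}).card = 3 * h + 4 := by
  have h1 := two_mul_card_matchingsAvoiding_one (G := G) {y, x, w, v}
  rw [(sum_card_sdiff_fourCycle hcol hK hvw hwx hxy hyv hxv hyw hreg hcard).1] at h1
  omega

end FourCycles

section TwoMatchings

variable {V : Type*} [Fintype V] [DecidableEq V] {G : SimpleGraph V} [DecidableRel G.Adj]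

/-- The number of 2-matchings in terms of the number of edges and the degrees. -/
lemma four_mul_card_matchingsAvoiding_two (S : Finset V) :
    4 * (matchingsAvoiding G 2 S).card +
      2 * ∑ v ∈ Sᶜ, (G.neighborFinset v \ S).card ^ 2 =
        2 * (matchingsAvoiding G 1 S).card * ((matchingsAvoiding G 1 S).card + 1) := by
  have h1 : ∀ v ∈ Sᶜ, ∀ w ∈ G.neighborFinset v \ S,
      (matchingsAvoiding G 1 (insert w (insert v S))).card +
        ((G.neighborFinset v \ S).card + (G.neighborFinset w \ S).card) =
      (matchingsAvoiding G 1 S).card + 1 := by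
    intro v hv w hw
    rw [Finset.mem_compl] at hv
    rw [Finset.mem_sdiff, mem_neighborFinset] at hw
    have h2 := card_matchingsAvoiding_succ (G := G) (k := 0) hv
    have h3 := card_matchingsAvoiding_succ (G := G) (k := 0) (S := insert v S) (v := w)
      (by simp [hw.1.ne', hw.2])
    simp only [card_matchingsAvoiding_zero, Finset.sum_const, smul_eq_mul, mul_one, zero_add]
      at h2 h3
    have h4 : v ∈ G.neighborFinset w \ S := by simp [hw.1.symm, hv]
    have h5 := Finset.card_erase_add_one h4
    rw [Finset.erase_eq, Finset.sdiff_sdiff_left', ← Finset.sdiff_union_distrib, Finset.union_comm,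
      ← Finset.insert_eq] at h5
    omega
  have h2 := Finset.sum_congr rfl fun v hv ↦ Finset.sum_congr rfl (h1 v hv)
  have h3 : ∑ v ∈ Sᶜ, ∑ w ∈ G.neighborFinset v \ S, (G.neighborFinset w \ S).card =
      ∑ w ∈ Sᶜ, ∑ v ∈ G.neighborFinset w \ S, (G.neighborFinset w \ S).card :=
    Finset.sum_comm' fun v w ↦ by
      simp only [Finset.mem_compl, Finset.mem_sdiff, mem_neighborFinset, G.adj_comm v w]
      tauto
  have h4 := two_mul_card_matchingsAvoiding_succ (G := G) 1 S
  simp only [Finset.sum_add_distrib, h3, ← h4, Finset.sum_const, smul_eq_mul, mul_one] at h2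
  rw [← Finset.sum_mul, ← two_mul_card_matchingsAvoiding_one] at h2
  simp only [pow_two]
  linarith

end TwoMatchings

section CopyCounts

variable {V : Type*}

lemma sum_eq_sum_mem_mul [Fintype V] [DecidableEq V] (s : Finset V) (f : V → ℕ) :
    ∑ v ∈ s, f v = ∑ v, (if v ∈ s then 1 else 0) * f v := by
  simp

lemma card_copy_cycleGraph_four [Fintype V] [DecidableEq V] (G : SimpleGraph V)
    [DecidableRel G.Adj] : Nat.card (Copy (cycleGraph 4) G) = fourCycleCount G := by
  let P : V × V × V × V → Prop := fun p ↦
    p.2.1 ∈ G.neighborFinset p.1 ∧ p.2.2.1 ∈ G.neighborFinset p.2.1 \ {p.1} ∧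
      p.2.2.2 ∈ G.neighborFinset p.2.2.1 \ {p.2.1, p.1} ∧ G.Adj p.2.2.2 p.1
  have h1 : fourCycleCount G = Nat.card {p // P p} := by
    rw [Nat.card_eq_fintype_card, Fintype.card_subtype, Finset.card_filter]
    simp only [fourCycleCount,
      fun v f ↦ sum_eq_sum_mem_mul (G.neighborFinset v) f,
      fun v S f ↦ sum_eq_sum_mem_mul (G.neighborFinset v \ S) f, Finset.mul_sum,
      Fintype.sum_prod_type,
      P, ite_and, ite_mul, one_mul, zero_mul]
  rw [h1]
  refine Nat.card_eq_of_bijective (fun f ↦ ⟨(f 0, f 1, f 2, f 3), ?_⟩) ⟨?_, ?_⟩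
  · have hadj : ∀ i j, (cycleGraph 4).Adj i j → G.Adj (f i) (f j) := fun i j h ↦ f.toHom.map_adj h
    have hinj : ∀ i j, i ≠ j → f i ≠ f j := fun i j h ↦ f.injective.ne h
    simp [P, hadj 0 1 (by decide), hadj 1 2 (by decide), hadj 2 3 (by decide),
      hadj 3 0 (by decide), hinj]
  · intro f g h
    simp only [Subtype.mk.injEq, Prod.mk.injEq] at h
    ext i
    fin_cases i
    exacts [h.1, h.2.1, h.2.2.1, h.2.2.2]
  · rintro ⟨⟨a, b, c, d⟩, h1, h2, h3, h4⟩
    simp only [Finset.mem_sdiff, mem_neighborFinset, Finset.mem_insert, Finset.mem_singleton,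
      not_or] at h1 h2 h3 h4
    obtain ⟨f, hf⟩ := exists_copy_cycleGraph_four h1 h2.1 h3.1 h4 h2.2 h3.2.1
    refine ⟨f, ?_⟩
    simp [hf]

lemma card_copy_cycleGraph_four_self :
    Nat.card (Copy (cycleGraph 4) (cycleGraph 4)) = 8 := by
  rw [card_copy_cycleGraph_four]
  decide +kernel

instance (n : ℕ) : DecidableRel (pathGraph n).Adj :=
  fun _ _ ↦ decidable_of_iff _ pathGraph_adj.symm

instance {W : Type*} (G : SimpleGraph V) (H : SimpleGraph W) [DecidableRel G.Adj]
    [DecidableRel H.Adj] : DecidableRel (G ⊕g H).Adj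
  | .inl a, .inl b => decidable_of_iff (G.Adj a b) sum_adj_inl.symm
  | .inr a, .inr b => decidable_of_iff (H.Adj a b) sum_adj_inr.symm
  | .inl _, .inr _ => .isFalse (not_adj_sum_inl_inr _ _)
  | .inr _, .inl _ => .isFalse fun h ↦ not_adj_sum_inl_inr _ _ h.symm

lemma exists_copy_pathGraph_sum {G : SimpleGraph V} {v w x y z u a b : V}
    (hvw : G.Adj v w) (hwx : G.Adj w x)
    (hxy : G.Adj x y) (hyz : G.Adj y z) (hzu : G.Adj z u) (hab : G.Adj a b)
    (hn : [b, a, u, z, y, x, w, v].Nodup) :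
    ∃ f : Copy (pathGraph 6 ⊕g pathGraph 2) G,
      ⇑f = Sum.elim ![v, w, x, y, z, u] ![a, b] := by
  refine ⟨⟨⟨Sum.elim ![v, w, x, y, z, u] ![a, b], ?_⟩, ?_⟩, rfl⟩
  · rintro (i | i) (j | j) hij
    · fin_cases i <;> fin_cases j <;> first
        | exact absurd hij (by decide)
        | simp [hvw, hwx, hxy, hyz, hzu, hvw.symm, hwx.symm, hxy.symm, hyz.symm, hzu.symm]
    · simp at hij
    · simp at hij
    · fin_cases i <;> fin_cases j <;> first
        | exact absurd hij (by decide)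
        | simp [hab, hab.symm]
  · have h : ∀ i : Fin 6 ⊕ Fin 2, Sum.elim ![v, w, x, y, z, u] ![a, b] i =
        [v, w, x, y, z, u, a, b].get (finSumFinEquiv i : Fin (6 + 2)) := by
      rintro (i | i) <;> fin_cases i <;> rfl
    intro i j hij
    rw [RelHom.coeFn_mk, h, h] at hij
    exact finSumFinEquiv.injective (List.nodup_iff_injective_get.1 (List.nodup_reverse.2 hn) hij)

variable [Fintype V] [DecidableEq V] (G : SimpleGraph V) [DecidableRel G.Adj]

/-- The number of vertex sequences of a path with five edges together with a disjoint oriented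
edge. -/
def pathDartCount : ℕ :=
  ∑ v, ∑ w ∈ G.neighborFinset v, ∑ x ∈ G.neighborFinset w \ {v},
    ∑ y ∈ G.neighborFinset x \ {w, v}, ∑ z ∈ G.neighborFinset y \ {x, w, v},
      ∑ u ∈ G.neighborFinset z \ {y, x, w, v}, ∑ a ∈ {u, z, y, x, w, v}ᶜ,
        (G.neighborFinset a \ {u, z, y, x, w, v}).card

lemma pathDartCount_eq : pathDartCount G = 2 * pathMatchingCount G 5 1 := by
  simp only [pathDartCount, pathMatchingCount, pathSum, Finset.mul_sum,
    two_mul_card_matchingsAvoiding_one, insert_empty_eq, Finset.sdiff_empty]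

lemma card_copy_pathGraph_sum :
    Nat.card (Copy (pathGraph 6 ⊕g pathGraph 2) G) = pathDartCount G := by
  let P : V × V × V × V × V × V × V × V → Prop := fun ⟨v, w, x, y, z, u, a, b⟩ ↦
    w ∈ G.neighborFinset v ∧ x ∈ G.neighborFinset w \ {v} ∧ y ∈ G.neighborFinset x \ {w, v} ∧
      z ∈ G.neighborFinset y \ {x, w, v} ∧ u ∈ G.neighborFinset z \ {y, x, w, v} ∧
      a ∈ ({u, z, y, x, w, v} : Finset V)ᶜ ∧ b ∈ G.neighborFinset a \ {u, z, y, x, w, v}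
  have : DecidablePred P := fun p ↦ inferInstanceAs (Decidable (_ ∧ _))
  have h1 : pathDartCount G = Nat.card {p // P p} := by
    rw [Nat.card_eq_fintype_card, Fintype.card_subtype, Finset.card_filter]
    simp only [pathDartCount, Finset.card_eq_sum_ones,
      fun v f ↦ sum_eq_sum_mem_mul (G.neighborFinset v) f,
      fun v S f ↦ sum_eq_sum_mem_mul (G.neighborFinset v \ S) f,
      fun S f ↦ sum_eq_sum_mem_mul (Sᶜ : Finset V) f, Finset.mul_sum, Fintype.sum_prod_type, P,
      ite_mul, one_mul, zero_mul, ← ite_and]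
    congr!
  rw [h1]
  refine Nat.card_eq_of_bijective (fun f ↦ ⟨(f (.inl 0), f (.inl 1), f (.inl 2), f (.inl 3),
    f (.inl 4), f (.inl 5), f (.inr 0), f (.inr 1)), ?_⟩) ⟨?_, ?_⟩
  · have hadj : ∀ i j, (pathGraph 6).Adj i j → G.Adj (f (.inl i)) (f (.inl j)) :=
      fun i j h ↦ f.toHom.map_adj (sum_adj_inl.2 h)
    have hadj' : G.Adj (f (.inr 0)) (f (.inr 1)) :=
      f.toHom.map_adj (sum_adj_inr.2 (by decide))
    have hinj : ∀ i j, i ≠ j → f i ≠ f j := fun i j h ↦ f.injective.ne h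
    simp [P, hadj 0 1 (by decide), hadj 1 2 (by decide), hadj 2 3 (by decide),
      hadj 3 4 (by decide), hadj 4 5 (by decide), hadj', hinj]
  · intro f g h
    simp only [Subtype.mk.injEq, Prod.mk.injEq] at h
    obtain ⟨h0, h1, h2, h3, h4, h5, h6, h7⟩ := h
    ext (i | i) <;> fin_cases i <;> assumption
  · rintro ⟨⟨v, w, x, y, z, u, a, b⟩, hw, hx, hy, hz, hu, ha, hb⟩
    simp only [Finset.mem_sdiff, mem_neighborFinset, Finset.mem_insert, Finset.mem_singleton,
      Finset.mem_compl, not_or] at hw hx hy hz hu ha hb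
    obtain ⟨f, hf⟩ := exists_copy_pathGraph_sum hw hx.1 hy.1 hz.1 hu.1 hb.1 (by
      simp only [List.nodup_cons, List.mem_cons, List.not_mem_nil, or_false, not_or,
        List.nodup_nil, and_true, not_false_eq_true]
      simp [ha, hb, hu, hz, hy, hx, hw.ne', hx.1.ne', hy.1.ne', hz.1.ne', hu.1.ne', hb.1.ne'])
    refine ⟨f, ?_⟩
    simp [hf]

lemma card_copy_pathGraph_sum_self :
    Nat.card (Copy (pathGraph 6 ⊕g pathGraph 2) (pathGraph 6 ⊕g pathGraph 2)) = 4 := by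
  rw [card_copy_pathGraph_sum]
  decide +kernel

end CopyCounts

/-- Solve the recursions relating matchings and paths of at most five edges. -/
lemma solve_matching_recursions {h N : ℚ} {m : ℕ → ℚ} {P U : ℕ → ℕ → ℚ}
    (hm : m 0 = 1) (hzero : ∀ j, U j 0 = P j 0)
    (hsucc : ∀ j k, U j (k + 1) = P j (k + 1) + P (j + 1) k)
    (hP0 : ∀ k : ℕ, P 0 k + 2 * k * m k = (2 * h + 8) * m k)
    (hU0 : ∀ k, U 0 k = (2 * h + 8) * m k) (hU1 : ∀ k, U 1 k = 3 * P 0 k)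
    (hU2 : ∀ k, U 2 k = 2 * P 1 k) (hU3 : ∀ k, U 3 k = 2 * P 2 k)
    (hU40 : U 4 0 + 48 = 2 * P 3 0) (hU41 : U 4 1 + (3 * h + 4) * 48 = 2 * P 3 1)
    (hU42 : U 4 2 + (9 * h ^ 2 + 9 * h + 4) * 24 = 2 * P 3 2)
    (hU50 : U 5 0 + 48 = 2 * P 4 0) (hP51 : P 5 1 = 2 * N) :
    480 * m 6 = 486 * h ^ 6 - 486 * h ^ 5 - 2970 * h ^ 4 + 12150 * h ^ 3 - 33996 * h ^ 2 -
      5904 * h - 7680 + 80 * N := by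
  have hP00 : P 0 0 = 2 * h + 8 := by simpa [hm] using hP0 0
  have hP0' : ∀ k : ℕ, P 0 k = (2 * h + 8 - 2 * k) * m k := fun k ↦ by linarith [hP0 k]
  have hm' : ∀ k : ℕ, (2 * k + 2) * m (k + 1) = P 1 k := fun k ↦ by
    have h1 := hP0 (k + 1)
    push_cast at h1
    linarith [hU0 (k + 1), hsucc 0 k]
  have hP1 : ∀ k, P 1 (k + 1) = 3 * P 0 (k + 1) - P 2 k := fun k ↦ by
    linarith [hU1 (k + 1), hsucc 1 k]
  have hP2 : ∀ k, P 2 (k + 1) = 2 * P 1 (k + 1) - P 3 k := fun k ↦ by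
    linarith [hU2 (k + 1), hsucc 2 k]
  have hP3 : ∀ k, P 3 (k + 1) = 2 * P 2 (k + 1) - P 4 k := fun k ↦ by
    linarith [hU3 (k + 1), hsucc 3 k]
  have hP10 : P 1 0 = 6 * h + 24 := by linarith [hzero 1, hU1 0]
  have hP20 : P 2 0 = 12 * h + 48 := by linarith [hzero 2, hU2 0]
  have hP30 : P 3 0 = 24 * h + 96 := by linarith [hzero 3, hU3 0]
  have hP40 : P 4 0 = 48 * h + 144 := by linarith [hzero 4]
  have hP50 : P 5 0 = 96 * h + 240 := by linarith [hzero 5]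
  have hm1 : m 1 = 3 * h + 12 := by
    have h1 := hm' 0
    norm_num at h1
    linarith
  have hP01 := hP0' 1
  rw [hm1] at hP01
  have hP41 : P 4 1 = 2 * P 3 1 - (3 * h + 4) * 48 - P 5 0 := by linarith [hsucc 4 0]
  have hP42 : P 4 2 = 2 * P 3 2 - (9 * h ^ 2 + 9 * h + 4) * 24 - P 5 1 := by linarith [hsucc 4 1]
  have hm2 : m 2 = 9 / 2 * h ^ 2 + 57 / 2 * h + 42 := by
    have h1 := hm' 1
    norm_num at h1 hP01
    linarith [hP1 0]
  have hP02 := hP0' 2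
  rw [hm2] at hP02
  have hm3 : m 3 = 9 / 2 * h ^ 3 + 63 / 2 * h ^ 2 + 65 * h + 44 := by
    have h1 := hm' 2
    norm_num at h1 hP01 hP02
    linarith [hP1 0, hP1 1, hP2 0]
  have hP03 := hP0' 3
  rw [hm3] at hP03
  have hm4 : m 4 = 27 / 8 * h ^ 4 + 81 / 4 * h ^ 3 + 273 / 8 * h ^ 2 + 117 / 4 * h + 9 := by
    have h1 := hm' 3
    norm_num at h1 hP01 hP02 hP03
    linarith [hP1 0, hP1 1, hP1 2, hP2 0, hP2 1, hP3 0]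
  have hP04 := hP0' 4
  rw [hm4] at hP04
  have hm5 : m 5 = 81 / 40 * h ^ 5 + 27 / 4 * h ^ 4 - 9 / 8 * h ^ 3 + 39 / 4 * h ^ 2 -
      27 / 5 * h := by
    have h1 := hm' 4
    norm_num at h1 hP01 hP02 hP03 hP04
    linarith [hP1 0, hP1 1, hP1 2, hP1 3, hP2 0, hP2 1, hP2 2, hP3 0, hP3 1]
  have hP05 := hP0' 5
  rw [hm5] at hP05
  have h1 := hm' 5
  norm_num at h1 hP01 hP02 hP03 hP04 hP05
  linarith [hP1 0, hP1 1, hP1 2, hP1 3, hP1 4, hP2 0, hP2 1, hP2 2, hP2 3, hP3 0, hP3 1, hP3 2]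

theorem stmt_15 {V : Type*} [Fintype V] [DecidableEq V] (G : SimpleGraph V) [DecidableRel G.Adj]
    (hreg : G.IsRegularOfDegree 3) (hbip : G.Colorable 2) (h : ℕ)
    (hcard : Fintype.card V = 2 * h + 8)
    (hsix : numSubgraphs G (cycleGraph 4) = 6)
    (hshare : ∀ H₁ H₂ : G.Subgraph, Nonempty (H₁.coe ≃g cycleGraph 4) →
      Nonempty (H₂.coe ≃g cycleGraph 4) → H₁ ≠ H₂ →
      (H₁.edgeSet ∩ H₂.edgeSet).ncard ≤ 1) :
    (480 * numMatchings G 6 : ℤ) =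
      486 * (h : ℤ) ^ 6 - 486 * (h : ℤ) ^ 5 - 2970 * (h : ℤ) ^ 4 + 12150 * (h : ℤ) ^ 3
        - 33996 * (h : ℤ) ^ 2 - 5904 * (h : ℤ) - 7680
        + 80 * numSubgraphs G (pathGraph 6 ⊕g pathGraph 2) := by
  obtain ⟨c⟩ := hbip
  have hcol : ∀ ⦃a b⦄, G.Adj a b → decide (c a = 0) ≠ decide (c b = 0) := by
    intro a b hab hcab
    have h1 := c.valid hab
    rw [decide_eq_decide] at hcab
    generalize c a = i, c b = j at h1 hcab
    omega
  have hK := @false_of_common_neighbors V G _ hshare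
  have hQ : fourCycleCount G = 48 := by
    rw [← card_copy_cycleGraph_four, card_copy_eq_numSubgraphs_mul, hsix,
      card_copy_cycleGraph_four_self]
  have hN : 2 * pathMatchingCount G 5 1 =
      numSubgraphs G (pathGraph 6 ⊕g pathGraph 2) * 4 := by
    rw [← pathDartCount_eq, ← card_copy_pathGraph_sum, card_copy_eq_numSubgraphs_mul,
      card_copy_pathGraph_sum_self]
  obtain ⟨c₂, hc₂⟩ : ∃ c₂, 2 * c₂ = 9 * h ^ 2 + 9 * h + 4 := by
    obtain ⟨r, hr⟩ := Nat.even_mul_succ_self h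
    exact ⟨9 * r + 2, by linear_combination 9 * hr.symm⟩
  have h40 := openPathMatchingCount_four hreg hcol (k := 0) (m := 1)
    fun _ _ _ _ _ _ _ _ _ _ ↦ card_matchingsAvoiding_zero _
  have h41 := openPathMatchingCount_four hreg hcol (k := 1) (m := 3 * h + 4)
    fun v w x y hvw hwx hxy hyv hxv hyw ↦
    card_matchingsAvoiding_one_fourCycle hcol hK hvw hwx hxy hyv hxv hyw hreg hcard
  have h42 := openPathMatchingCount_four hreg hcol (k := 2) (m := c₂)
    fun v w x y hvw hwx hxy hyv hxv hyw ↦ by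
    have h1 := four_mul_card_matchingsAvoiding_two (G := G) {y, x, w, v}
    rw [(sum_card_sdiff_fourCycle hcol hK hvw hwx hxy hyv hxv hyw hreg hcard).2,
      card_matchingsAvoiding_one_fourCycle hcol hK hvw hwx hxy hyv hxv hyw hreg hcard] at h1
    linarith
  have h50 := openPathMatchingCount_five hreg hcol
  rw [hQ] at h40 h41 h42 h50
  have h42' : openPathMatchingCount G 4 2 + (9 * h ^ 2 + 9 * h + 4) * 24 =
      2 * pathMatchingCount G 3 2 := by
    rw [← hc₂, ← h42]
    ring
  have hN' : pathMatchingCount G 5 1 = 2 * numSubgraphs G (pathGraph 6 ⊕g pathGraph 2) := by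
    lia
  simp only [numMatchings_eq_card_matchingsAvoiding]
  have key := solve_matching_recursions (h := h)
    (N := numSubgraphs G (pathGraph 6 ⊕g pathGraph 2))
    (m := fun k ↦ (matchingsAvoiding G k ∅).card)
    (P := fun j k ↦ pathMatchingCount G j k) (U := fun j k ↦ openPathMatchingCount G j k)
    (by simp [card_matchingsAvoiding_zero])
    (fun j ↦ by exact_mod_cast openPathMatchingCount_zero_right j)
    (fun j k ↦ by exact_mod_cast openPathMatchingCount_succ j k)
    (fun k ↦ by exact_mod_cast hcard ▸ pathMatchingCount_zero (G := G) k)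
    (fun k ↦ by exact_mod_cast hcard ▸ openPathMatchingCount_zero (G := G) k)
    (fun k ↦ by exact_mod_cast openPathMatchingCount_one hreg k)
    (fun k ↦ by exact_mod_cast openPathMatchingCount_two hreg k)
    (fun k ↦ by exact_mod_cast openPathMatchingCount_three hreg hcol k)
    (by exact_mod_cast h40) (by exact_mod_cast h41)
    (by exact_mod_cast h42') (by exact_mod_cast h50) (by exact_mod_cast hN')
  exact_mod_cast key
end

section
/- Let t ≥ 1 be an integer and let G be a finite simple 3-regular bipartite graph on exactly 6t+8 vertices having exactly six cycles of length 4, any two distinct 4-cycles of G sharing at most one edge, and having exactly 4t+7 cycles of length 6. Then, writing h = 3t, the number of 6-matchings of G satisfies 240·M(G,6) = 243h⁶ − 243h⁵ − 1485h⁴ + 6075h³ − 11238h² + 9848h − 2160 (i.e. M(G,6) = (81/80)h⁶ − (81/80)h⁵ − (99/16)h⁴ + (405/16)h³ − (1873/40)h² + (1231/30)h − 9). -/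
open SimpleGraph

namespace CopyCount

/-- The value at `x` of the polynomial with coefficient list `p`. -/
def evalList (x : ℤ) : List ℤ → ℤ
  | [] => 0
  | c :: p => c + x * evalList x p

/-- Addition of coefficient lists. -/
def addList : List ℤ → List ℤ → List ℤ
  | [], q => q
  | p, [] => p
  | c :: p, d :: q => (c + d) :: addList p q

/-- Multiplication of a coefficient list by a scalar. -/
def smulList (c : ℤ) : List ℤ → List ℤ
  | [] => []
  | d :: p => c * d :: smulList c p

/-- Whether the pair `(u, w)` occurs in the list of edges `E`. -/
def hasEdge (E : List (ℕ × ℕ)) (u w : ℕ) : Bool := E.any fun e ↦ e.1.beq u && e.2.beq w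

/-- The transposition of `p` and `q`, in a form that evaluates quickly. -/
def swapLabel (p q k : ℕ) : ℕ := bif k.beq p then q else bif k.beq q then p else k

/-- Exchange of the labels `j` and `b` on the right side of `E`. -/
def swapRight (j b : ℕ) (E : List (ℕ × ℕ)) : List (ℕ × ℕ) :=
  E.map fun e ↦ (e.1, swapLabel j b e.2)

/-- A left label below `a` joined by `E` to the right label `w`. -/
def leftNeighbor (a : ℕ) (E : List (ℕ × ℕ)) (w : ℕ) : Option ℕ :=
  (List.range a).find? fun i ↦ hasEdge E i w

/-- Whether a symmetry of `E` fixing the left label `u` exchanges the right labels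
`w - 1` and `w`. -/
def isTwin (a : ℕ) (E : List (ℕ × ℕ)) (u : ℕ) : ℕ → Bool
  | 0 => false
  | w + 1 =>
    match leftNeighbor a E w, leftNeighbor a E (w + 1) with
    | some p, some q => !p.beq u && !q.beq u &&
        E.all fun e ↦ hasEdge E (swapLabel p q e.1) (swapLabel w (w + 1) e.2)
    | _, _ => false

/-- The sum of the values of `v` on the lists obtained from `E` by adding an edge `(u, w)`
with `w < n`, together with the last summand; `p₀` is the value of `E` itself. -/
def mergeSum (v : List (ℕ × ℕ) → Option (List ℤ)) (a : ℕ) (E : List (ℕ × ℕ)) (p₀ : List ℤ)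
    (u : ℕ) : ℕ → Option (List ℤ × List ℤ)
  | 0 => some ([], [])
  | w + 1 =>
    (mergeSum v a E p₀ u w).bind fun s ↦
      (bif hasEdge E u w then some p₀ else bif isTwin a E u w then some s.2
        else v ((u, w) :: E)).map fun p ↦ (addList s.1 p, p)

/-- Whether all pairs of labels `i < a` and `j < b` are in `E`. -/
def isComplete (a b : ℕ) (E : List (ℕ × ℕ)) : Bool :=
  (List.range a).all fun i ↦ (List.range b).all fun j ↦ hasEdge E i j

/-- Whether `E` is, on three left and three right labels, the complement of a perfect
matching. -/
def isHexagon (E : List (ℕ × ℕ)) : Bool :=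
  [![0, 1, 2], ![0, 2, 1], ![1, 0, 2], ![1, 2, 0], ![2, 0, 1], ![2, 1, 0]].any
    fun σ : Fin 3 → Fin 3 ↦ (List.finRange 3).all fun i ↦ (List.finRange 3).all fun j ↦
      (hasEdge E i j).xor ((j : ℕ).beq (σ i))

/-- The value of a list of edges without vertices of degree at most one. -/
def coreValue (E : List (ℕ × ℕ)) : ℕ → ℕ → Option (List ℤ)
  | 0, 0 => some [1]
  | 2, 2 => bif isComplete 2 2 E then some [24] else none
  | 3, 3 => bif isHexagon E then some [42, 24] else none
  | 2, 3 => bif isComplete 2 3 E then some [] else none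
  | 3, 2 => bif isComplete 3 2 E then some [] else none
  | _, _ => none

/-- The value of a list of edges whose right vertex `b` has degree at most one. -/
def lastValue (v : List (ℕ × ℕ) → Option (List ℤ)) (a b : ℕ) (E : List (ℕ × ℕ)) :
    Option (List ℤ) :=
  (v (E.filter fun e ↦ !e.2.beq b)).bind fun p₀ ↦
    match E.filter fun e ↦ e.2.beq b with
    | [] => some (addList (smulList (4 - b) p₀) (0 :: smulList 3 p₀))
    | [e] => bif e.1.blt a then
        (mergeSum v a (E.filter fun e ↦ !e.2.beq b) p₀ e.1 b).map fun s ↦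
          addList (smulList 3 p₀) (smulList (-1) s.1)
      else none
    | _ => none

/-- The largest label below `b` with the property `P`. -/
def findLast (P : ℕ → Bool) : ℕ → Option ℕ
  | 0 => none
  | j + 1 => bif P j then some j else findLast P j

/-- The number of copies of the bipartite graph with `a` left vertices, `b` right vertices and
edges `E`, as a polynomial; vertices of degree at most one are removed one by one, and the first
argument bounds the number of steps. -/
def copyValue : ℕ → ℕ → ℕ → List (ℕ × ℕ) → Option (List ℤ)
  | 0, _, _, _ => none
  | k + 1, a, b, E =>
    match findLast (fun j ↦ (E.countP fun e ↦ e.2.beq j).ble 1) b with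
    | some j => lastValue (copyValue k a (b - 1)) a (b - 1) (swapRight j (b - 1) E)
    | none =>
      match findLast (fun i ↦ (E.countP fun e ↦ e.1.beq i).ble 1) a with
      | some _ => copyValue k b a (E.map Prod.swap)
      | none => coreValue E a b

variable {α β : Type*}

/-- Pairs of injective labellings realizing all edges of `E` with labels below `a` and `b`. -/
def IsCopy (r : α → β → Prop) (a b : ℕ) (E : List (ℕ × ℕ))
    (p : (Fin a → α) × (Fin b → β)) : Prop :=
  p.1.Injective ∧ p.2.Injective ∧ ∀ (i : Fin a) (j : Fin b), ((i : ℕ), (j : ℕ)) ∈ E →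
    r (p.1 i) (p.2 j)

section
variable [Fintype α] [Fintype β]

open Classical in
/-- The set of copies in `r` of the bipartite graph with edges `E`. -/
noncomputable def copies (r : α → β → Prop) (a b : ℕ) (E : List (ℕ × ℕ)) :
    Finset ((Fin a → α) × (Fin b → β)) :=
  {p | IsCopy r a b E p}

theorem mem_copies {r : α → β → Prop} {a b : ℕ} {E : List (ℕ × ℕ)}
    {p : (Fin a → α) × (Fin b → β)} : p ∈ copies r a b E ↔ IsCopy r a b E p := by
  simp [copies]

theorem card_copies_perm (r : α → β → Prop) {a b : ℕ} {E E' : List (ℕ × ℕ)}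
    (σ : Equiv.Perm (Fin a)) (τ : Equiv.Perm (Fin b))
    (h : ∀ (i : Fin a) (j : Fin b), ((i : ℕ), (j : ℕ)) ∈ E' ↔ ((σ i : ℕ), (τ j : ℕ)) ∈ E) :
    (copies r a b E').card = (copies r a b E).card := by
  refine Finset.card_nbij' (fun p ↦ (p.1 ∘ σ.symm, p.2 ∘ τ.symm)) (fun p ↦ (p.1 ∘ σ, p.2 ∘ τ))
    ?_ ?_ ?_ ?_
  · rintro p hp
    obtain ⟨h1, h2, h3⟩ := mem_copies.1 hp
    refine mem_copies.2 ⟨h1.comp σ.symm.injective, h2.comp τ.symm.injective, fun i j hij ↦ ?_⟩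
    exact h3 _ _ ((h _ _).2 (by simpa using hij))
  · rintro p hp
    obtain ⟨h1, h2, h3⟩ := mem_copies.1 hp
    exact mem_copies.2 ⟨h1.comp σ.injective, h2.comp τ.injective,
      fun i j hij ↦ h3 _ _ ((h _ _).1 hij)⟩
  · intro p _
    simp [Function.comp_assoc]
  · intro p _
    simp [Function.comp_assoc]

theorem card_copies_congr (r : α → β → Prop) {a b : ℕ} {E E' : List (ℕ × ℕ)}
    (h : ∀ i < a, ∀ j < b, (i, j) ∈ E' ↔ (i, j) ∈ E) :
    (copies r a b E').card = (copies r a b E).card :=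
  card_copies_perm r 1 1 fun i j ↦ h i i.2 j j.2

theorem card_copies_flip (r : α → β → Prop) (a b : ℕ) (E : List (ℕ × ℕ)) :
    (copies (flip r) b a (E.map Prod.swap)).card = (copies r a b E).card := by
  refine Finset.card_nbij' Prod.swap Prod.swap ?_ ?_ (fun _ _ ↦ rfl) (fun _ _ ↦ rfl)
  · rintro p hp
    obtain ⟨h1, h2, h3⟩ := mem_copies.1 hp
    exact mem_copies.2 ⟨h2, h1, fun i j hij ↦ h3 _ _ (by simpa using hij)⟩
  · rintro p hp
    obtain ⟨h1, h2, h3⟩ := mem_copies.1 hp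
    exact mem_copies.2 ⟨h2, h1, fun i j hij ↦ h3 _ _ (by simpa using hij)⟩

open Classical in
theorem card_copies_succ (r : α → β → Prop) (a b : ℕ) (E : List (ℕ × ℕ)) :
    (copies r a (b + 1) E).card = ∑ p ∈ copies r a b E,
      (Finset.univ.filter fun y ↦
        y ∉ Set.range p.2 ∧ ∀ i : Fin a, ((i : ℕ), b) ∈ E → r (p.1 i) y).card := by
  rw [← Finset.card_sigma]
  refine Finset.card_nbij' (fun p ↦ ⟨(p.1, Fin.init p.2), p.2 (Fin.last b)⟩)
    (fun q ↦ (q.1.1, Fin.snoc q.1.2 q.2)) ?_ ?_ ?_ ?_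
  · rintro ⟨f, g⟩ hp
    obtain ⟨h1, h2, h3⟩ := mem_copies.1 hp
    rw [← Fin.snoc_init_self g, Fin.snoc_injective_iff] at h2
    simp only [Finset.coe_sigma, Set.mem_sigma_iff, Finset.mem_coe, mem_copies,
      Finset.mem_filter, Finset.mem_univ, true_and]
    exact ⟨⟨h1, h2.1, fun i j hij ↦ h3 i j.castSucc hij⟩, h2.2,
      fun i hi ↦ h3 i (Fin.last b) hi⟩
  · rintro ⟨⟨f, g⟩, y⟩ hq
    simp only [Finset.coe_sigma, Set.mem_sigma_iff, Finset.mem_coe, mem_copies,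
      Finset.mem_filter, Finset.mem_univ, true_and] at hq
    obtain ⟨⟨h1, h2, h3⟩, h4, h5⟩ := hq
    refine mem_copies.2 ⟨h1, Fin.snoc_injective_iff.2 ⟨h2, h4⟩, fun i j ↦ ?_⟩
    induction j using Fin.lastCases with
    | last => simpa using h5 i
    | cast j => simpa using h3 i j
  · rintro ⟨f, g⟩ _
    simp
  · rintro ⟨⟨f, g⟩, y⟩ _
    simp

theorem card_copies_isolated (r : α → β → Prop) {a b : ℕ} {E : List (ℕ × ℕ)}
    (h : ∀ i < a, (i, b) ∉ E) :
    (copies r a (b + 1) E).card + b * (copies r a b E).card =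
      Fintype.card β * (copies r a b E).card := by
  classical
  have key : ∀ p ∈ copies r a b E, (Finset.univ.filter fun y ↦
      y ∉ Set.range p.2 ∧ ∀ i : Fin a, ((i : ℕ), b) ∈ E → r (p.1 i) y).card + b =
        Fintype.card β := by
    intro p hp
    have h1 : (Finset.univ.filter fun y ↦
        y ∉ Set.range p.2 ∧ ∀ i : Fin a, ((i : ℕ), b) ∈ E → r (p.1 i) y) =
        (Finset.univ.image p.2)ᶜ := by
      ext y
      simp only [Finset.mem_filter, Finset.mem_univ, true_and, Finset.mem_compl,
        Finset.mem_image, Set.mem_range, and_iff_left_iff_imp]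
      exact fun _ i hi ↦ absurd hi (h i i.2)
    have h2 : (Finset.univ.image p.2).card = b := by
      rw [Finset.card_image_of_injective _ (mem_copies.1 hp).2.1, Finset.card_fin]
    rw [h1, Finset.card_compl, h2, Nat.sub_add_cancel (h2 ▸ Finset.card_le_univ _)]
  rw [card_copies_succ, mul_comm b, mul_comm _ (copies r a b E).card, ← smul_eq_mul,
    ← smul_eq_mul, ← Finset.sum_const, ← Finset.sum_const, ← Finset.sum_add_distrib]
  exact Finset.sum_congr rfl key

theorem card_copies_leaf (r : α → β → Prop) {d : ℕ}
    (hd : ∀ x, {y | r x y}.ncard = d) {a b u : ℕ} {E : List (ℕ × ℕ)} (hu : u < a)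
    (h : ∀ i < a, (i, b) ∈ E ↔ i = u) :
    (copies r a (b + 1) E).card + ∑ w ∈ Finset.range b, (copies r a b ((u, w) :: E)).card =
      d * (copies r a b E).card := by
  classical
  have hcons (w : Fin b) : (copies r a b ((u, (w : ℕ)) :: E)).card =
      ∑ p ∈ copies r a b E, if r (p.1 ⟨u, hu⟩) (p.2 w) then 1 else 0 := by
    rw [← Finset.card_filter]
    congr 1
    ext p
    simp only [mem_copies, Finset.mem_filter, IsCopy, List.mem_cons, Prod.mk.injEq]
    constructor
    · rintro ⟨h1, h2, h3⟩
      exact ⟨⟨h1, h2, fun i j hij ↦ h3 i j (.inr hij)⟩, h3 ⟨u, hu⟩ w (.inl ⟨rfl, rfl⟩)⟩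
    · rintro ⟨⟨h1, h2, h3⟩, h4⟩
      refine ⟨h1, h2, fun i j hij ↦ ?_⟩
      obtain ⟨hi, hj⟩ | hij := hij
      · obtain rfl : i = ⟨u, hu⟩ := Fin.ext hi
        obtain rfl : j = w := Fin.ext hj
        exact h4
      · exact h3 i j hij
  have key : ∀ p ∈ copies r a b E, (Finset.univ.filter fun y ↦
      y ∉ Set.range p.2 ∧ ∀ i : Fin a, ((i : ℕ), b) ∈ E → r (p.1 i) y).card +
        ∑ w : Fin b, (if r (p.1 ⟨u, hu⟩) (p.2 w) then 1 else 0) = d := by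
    intro p hp
    have h1 : (Finset.univ.filter fun y ↦
        y ∉ Set.range p.2 ∧ ∀ i : Fin a, ((i : ℕ), b) ∈ E → r (p.1 i) y) =
        (Finset.univ.filter fun y ↦ r (p.1 ⟨u, hu⟩) y).filter fun y ↦ y ∉ Set.range p.2 := by
      ext y
      simp only [Finset.mem_filter, Finset.mem_univ, true_and, h _ (Fin.is_lt _)]
      rw [and_comm]
      refine and_congr_left fun _ ↦ ⟨fun H ↦ H _ rfl, ?_⟩
      rintro H i rfl
      exact H
    have h2 : ∑ w : Fin b, (if r (p.1 ⟨u, hu⟩) (p.2 w) then 1 else 0) =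
        ((Finset.univ.filter fun y ↦ r (p.1 ⟨u, hu⟩) y).filter
          fun y ↦ y ∈ Set.range p.2).card := by
      rw [← Finset.card_filter, ← Finset.card_image_of_injective _ (mem_copies.1 hp).2.1]
      congr 1
      ext y
      simp only [Finset.mem_image, Finset.mem_filter, Finset.mem_univ, true_and, Set.mem_range]
      constructor
      · rintro ⟨w, hw, rfl⟩
        exact ⟨hw, w, rfl⟩
      · rintro ⟨hw, w, rfl⟩
        exact ⟨w, hw, rfl⟩
    rw [h1, h2, add_comm, Finset.card_filter_add_card_filter_not, ← hd (p.1 ⟨u, hu⟩),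
      Set.ncard_eq_toFinset_card']
    congr 1
    ext
    simp
  rw [card_copies_succ, Finset.sum_range, Finset.sum_congr rfl fun w _ ↦ hcons w,
    Finset.sum_comm, ← Finset.sum_add_distrib, Finset.sum_congr rfl key, Finset.sum_const,
    smul_eq_mul, mul_comm]

/-- The local conditions on a bipartite graph which determine its number of `6`-matchings. -/
structure IsAdmissible (r : α → β → Prop) (t : ℕ) : Prop where
  card_left : Fintype.card α = 3 * t + 4
  card_right : Fintype.card β = 3 * t + 4
  degree_left : ∀ x, {y | r x y}.ncard = 3
  degree_right : ∀ y, {x | r x y}.ncard = 3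
  four_cycles : (copies r 2 2 [(0, 0), (0, 1), (1, 1), (1, 0)]).card = 24
  six_cycles : (copies r 3 3 [(0, 1), (0, 2), (1, 2), (1, 0), (2, 0), (2, 1)]).card =
    6 * (4 * t + 7)
  left_pair : ∀ x₁ x₂, x₁ ≠ x₂ → {y | r x₁ y ∧ r x₂ y}.ncard ≤ 2
  right_pair : ∀ y₁ y₂, y₁ ≠ y₂ → {x | r x y₁ ∧ r x y₂}.ncard ≤ 2

theorem IsAdmissible.flip {r : α → β → Prop} {t : ℕ} (h : IsAdmissible r t) :
    IsAdmissible (flip r) t where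
  card_left := h.card_right
  card_right := h.card_left
  degree_left := h.degree_right
  degree_right := h.degree_left
  four_cycles := by
    rw [← h.four_cycles, ← card_copies_flip r]
    exact card_copies_congr _ (by decide)
  six_cycles := by
    rw [← h.six_cycles, ← card_copies_flip r]
    exact card_copies_congr _ (by decide)
  left_pair := h.right_pair
  right_pair := h.left_pair

theorem evalList_addList (x : ℤ) (p q : List ℤ) :
    evalList x (addList p q) = evalList x p + evalList x q := by
  fun_induction addList p q <;> simp_all [evalList]
  ring

theorem evalList_smulList (x c : ℤ) (p : List ℤ) :
    evalList x (smulList c p) = c * evalList x p := by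
  induction p with
  | nil => simp [smulList, evalList]
  | cons d p ih => simp only [smulList, evalList, ih]; ring

theorem hasEdge_iff {E : List (ℕ × ℕ)} {u w : ℕ} : hasEdge E u w = true ↔ (u, w) ∈ E := by
  simp only [hasEdge, List.any_eq_true, Bool.and_eq_true, Nat.beq_eq, Prod.exists]
  constructor
  · rintro ⟨_, _, h, rfl, rfl⟩
    exact h
  · exact fun h ↦ ⟨_, _, h, rfl, rfl⟩

theorem swapLabel_eq (p q k : ℕ) : swapLabel p q k = Equiv.swap p q k := by
  simp [swapLabel, Equiv.swap_apply_def, Bool.cond_eq_ite]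

theorem coe_swap_fin {n : ℕ} (p q k : Fin n) :
    ((Equiv.swap p q k : Fin n) : ℕ) = Equiv.swap (p : ℕ) q k := by
  simp only [Equiv.swap_apply_def, Fin.ext_iff]
  split_ifs <;> rfl

theorem card_copies_swapRight (r : α → β → Prop) {a b j : ℕ} (hj : j < b + 1)
    (E : List (ℕ × ℕ)) :
    (copies r a (b + 1) (swapRight j b E)).card = (copies r a (b + 1) E).card := by
  refine card_copies_perm r 1 (Equiv.swap ⟨j, hj⟩ (Fin.last b)) fun i k ↦ ?_
  rw [coe_swap_fin]
  simp only [swapRight, List.mem_map, swapLabel_eq, Prod.mk.injEq, Prod.exists,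
    Equiv.Perm.one_apply, Fin.val_last]
  constructor
  · rintro ⟨_, _, h, rfl, h'⟩
    rw [← h']
    simpa using h
  · exact fun h ↦ ⟨_, _, h, rfl, by simp⟩

theorem card_copies_twin (r : α → β → Prop) {a b u w : ℕ} {E : List (ℕ × ℕ)} (hw : w + 1 < b)
    (h : isTwin a E u (w + 1) = true) :
    (copies r a b ((u, w + 1) :: E)).card = (copies r a b ((u, w) :: E)).card := by
  simp only [isTwin] at h
  split at h
  next p q hp hq =>
    have hpa : p < a := by simpa using List.mem_of_find?_eq_some hp
    have hqa : q < a := by simpa using List.mem_of_find?_eq_some hq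
    simp only [Bool.and_eq_true, Bool.not_eq_true', List.all_eq_true, hasEdge_iff,
      swapLabel_eq, Prod.forall] at h
    obtain ⟨⟨hpu, hqu⟩, hE⟩ := h
    have hpu : u ≠ p := fun h ↦ by simp [h] at hpu
    have hqu : u ≠ q := fun h ↦ by simp [h] at hqu
    refine card_copies_perm r (Equiv.swap ⟨p, hpa⟩ ⟨q, hqa⟩)
      (Equiv.swap ⟨w, by omega⟩ ⟨w + 1, hw⟩) fun i j ↦ ?_
    simp only [coe_swap_fin, List.mem_cons, Prod.mk.injEq]
    refine or_congr (and_congr ?_ ?_) ⟨hE _ _, fun h ↦ by simpa using hE _ _ h⟩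
    · rw [Equiv.swap_apply_eq_iff, Equiv.swap_apply_of_ne_of_ne hpu hqu]
    · rw [Equiv.swap_apply_eq_iff, Equiv.swap_apply_left]
  next => simp at h

theorem mergeSum_eq {r : α → β → Prop} {t a b u : ℕ} {E : List (ℕ × ℕ)}
    {v : List (ℕ × ℕ) → Option (List ℤ)} {p₀ : List ℤ}
    (hv : ∀ E p, v E = some p → ((copies r a b E).card : ℤ) = evalList t p)
    (h₀ : ((copies r a b E).card : ℤ) = evalList t p₀) {n : ℕ} (hn : n ≤ b)
    {s : List ℤ × List ℤ} (hs : mergeSum v a E p₀ u n = some s) :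
    (∑ w ∈ Finset.range n, (copies r a b ((u, w) :: E)).card : ℤ) = evalList t s.1 ∧
      ∀ w, w + 1 = n → ((copies r a b ((u, w) :: E)).card : ℤ) = evalList t s.2 := by
  induction n generalizing s with
  | zero =>
    obtain rfl : ([], []) = s := by simpa [mergeSum] using hs
    simp [evalList]
  | succ w ih =>
    simp only [mergeSum, Option.bind_eq_some_iff, Option.map_eq_some_iff] at hs
    obtain ⟨s', hs', p, hp, rfl⟩ := hs
    obtain ⟨ih1, ih2⟩ := ih (by omega) hs'
    suffices H : ((copies r a b ((u, w) :: E)).card : ℤ) = evalList t p by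
      refine ⟨by rw [Finset.sum_range_succ, ih1, H, evalList_addList], ?_⟩
      rintro w' hw'
      obtain rfl : w' = w := by omega
      exact H
    cases he : hasEdge E u w with
    | true =>
      obtain rfl : p₀ = p := by simpa [he] using hp
      rw [← h₀, card_copies_congr]
      intro i _ j _
      rw [hasEdge_iff] at he
      simp only [List.mem_cons, or_iff_right_iff_imp]
      rintro h
      rwa [h]
    | false =>
      cases ht : isTwin a E u w with
      | true =>
        obtain rfl : s'.2 = p := by simpa [he, ht] using hp
        obtain _ | w := w
        · simp [isTwin] at ht
        · rw [card_copies_twin r (by omega) ht, ih2 w rfl]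
      | false => exact hv _ _ (by simpa [he, ht] using hp)

theorem lastValue_eq {r : α → β → Prop} {t a b : ℕ} (hr : IsAdmissible r t)
    {E : List (ℕ × ℕ)} {v : List (ℕ × ℕ) → Option (List ℤ)} {p : List ℤ}
    (hv : ∀ E p, v E = some p → ((copies r a b E).card : ℤ) = evalList t p)
    (hp : lastValue v a b E = some p) :
    ((copies r a (b + 1) E).card : ℤ) = evalList t p := by
  simp only [lastValue, Option.bind_eq_some_iff] at hp
  obtain ⟨p₀, hp₀, hp⟩ := hp
  set E₀ := E.filter fun e ↦ !e.2.beq b with hE₀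
  have h₀ := hv _ _ hp₀
  have hmem (i j : ℕ) (hj : j < b) : (i, j) ∈ E₀ ↔ (i, j) ∈ E := by
    have : j ≠ b := by omega
    simp [hE₀, List.mem_filter, ← Bool.not_eq_true, this]
  have hEE₀ : (copies r a b E₀).card = (copies r a b E).card :=
    card_copies_congr r fun i _ j hj ↦ hmem i j hj
  split at hp
  next hnil =>
    have hiso : ∀ i < a, (i, b) ∉ E := fun i _ hi ↦
      List.filter_eq_nil_iff.1 hnil (i, b) hi (by simp)
    have h1 := card_copies_isolated r hiso
    rw [hr.card_right, ← hEE₀] at h1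
    obtain rfl := Option.some.inj hp
    simp only [evalList_addList, evalList_smulList, evalList, ← h₀]
    zify at h1
    linear_combination h1
  next e hsingle =>
    cases hlt : e.1.blt a with
    | false => simp [hlt] at hp
    | true =>
      simp only [hlt, cond_true, Option.map_eq_some_iff] at hp
      obtain ⟨s, hs, rfl⟩ := hp
      have hb : ∀ i < a, (i, b) ∈ E ↔ i = e.1 := by
        intro i _
        have h1 : (i, b) ∈ E ↔ (i, b) ∈ E.filter fun e ↦ e.2.beq b := by simp
        have h2 : e ∈ E.filter fun e ↦ e.2.beq b := by simp [hsingle]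
        have h3 : e.2 = b := by simpa using (List.mem_filter.1 h2).2
        rw [h1, hsingle, List.mem_singleton, Prod.ext_iff]
        simp [h3]
      have h1 := card_copies_leaf r hr.degree_left (by simpa using hlt) hb
      have h2 := (mergeSum_eq hv h₀ le_rfl hs).1
      have h3 : ∑ w ∈ Finset.range b, (copies r a b ((e.1, w) :: E)).card =
          ∑ w ∈ Finset.range b, (copies r a b ((e.1, w) :: E₀)).card :=
        Finset.sum_congr rfl fun w _ ↦ card_copies_congr r fun i _ j hj ↦ by
          simp only [List.mem_cons, hmem i j hj]
      rw [h3, ← hEE₀] at h1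
      zify at h1
      simp only [evalList_addList, evalList_smulList, ← h₀, ← h2]
      linear_combination h1
  next => simp at hp

theorem isComplete_iff {a b : ℕ} {E : List (ℕ × ℕ)} :
    isComplete a b E = true ↔ ∀ i < a, ∀ j < b, (i, j) ∈ E := by
  simp [isComplete, hasEdge_iff]

theorem isHexagon_iff {E : List (ℕ × ℕ)} (h : isHexagon E = true) :
    ∃ σ : Equiv.Perm (Fin 3), ∀ i j : Fin 3, ((i : ℕ), (j : ℕ)) ∈ E ↔ j ≠ σ i := by
  simp only [isHexagon, List.any_eq_true, List.all_eq_true, List.mem_finRange,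
    true_imp_iff] at h
  obtain ⟨σ, hσ, h⟩ := h
  have hinj : σ.Injective := by
    clear h
    revert σ
    decide
  refine ⟨Equiv.ofBijective σ (Finite.injective_iff_bijective.1 hinj), fun i j ↦ ?_⟩
  have := h i j
  rw [← hasEdge_iff, Equiv.ofBijective_apply, ne_eq, Fin.ext_iff, ← Nat.beq_eq]
  cases hh : hasEdge E i j <;> simp_all

theorem card_copies_two_three {r : α → β → Prop}
    (h : ∀ x₁ x₂, x₁ ≠ x₂ → {y | r x₁ y ∧ r x₂ y}.ncard ≤ 2) {E : List (ℕ × ℕ)}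
    (hE : isComplete 2 3 E = true) : (copies r 2 3 E).card = 0 := by
  rw [Finset.card_eq_zero, Finset.eq_empty_iff_forall_notMem]
  rintro ⟨f, g⟩ hp
  obtain ⟨h1, h2, h3⟩ := mem_copies.1 hp
  rw [isComplete_iff] at hE
  have hsub : Set.range g ⊆ {y | r (f 0) y ∧ r (f 1) y} := by
    rintro _ ⟨j, rfl⟩
    exact ⟨h3 0 j (hE _ (by simp) _ j.2), h3 1 j (hE _ (by simp) _ j.2)⟩
  have := Set.ncard_le_ncard hsub (Set.toFinite _)
  have h4 := h (f 0) (f 1) (h1.ne (by simp))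
  have h5 : (Set.range g).ncard = 3 := by
    rw [← Set.image_univ, Set.ncard_image_of_injective _ h2, Set.ncard_univ, Nat.card_fin]
  omega

theorem coreValue_eq {r : α → β → Prop} {t a b : ℕ} (hr : IsAdmissible r t)
    {E : List (ℕ × ℕ)} {p : List ℤ} (hp : coreValue E a b = some p) :
    ((copies r a b E).card : ℤ) = evalList t p := by
  unfold coreValue at hp
  split at hp
  next =>
    obtain rfl := Option.some.inj hp
    have : copies r 0 0 E = Finset.univ := by
      ext q
      simp [mem_copies, IsCopy, Function.injective_of_subsingleton]
    simp [this, evalList]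
  next =>
    cases hE : isComplete 2 2 E with
    | false => simp [hE] at hp
    | true =>
      obtain rfl : [24] = p := by simpa [hE] using hp
      rw [isComplete_iff] at hE
      rw [card_copies_congr r (E := [(0, 0), (0, 1), (1, 1), (1, 0)]), hr.four_cycles]
      · simp [evalList]
      · intro i hi j hj
        refine iff_of_true (hE i hi j hj) ?_
        revert j
        revert i
        decide
  next =>
    cases hE : isHexagon E with
    | false => simp [hE] at hp
    | true =>
      obtain rfl : [42, 24] = p := by simpa [hE] using hp
      obtain ⟨σ, hσ⟩ := isHexagon_iff hE
      rw [card_copies_perm r (E := [(0, 1), (0, 2), (1, 2), (1, 0), (2, 0), (2, 1)]) σ 1,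
        hr.six_cycles]
      · simp [evalList]
        ring
      · intro i j
        rw [hσ]
        generalize σ i = k
        revert k j
        decide
  next =>
    cases hE : isComplete 2 3 E with
    | false => simp [hE] at hp
    | true =>
      obtain rfl : [] = p := by simpa [hE] using hp
      simp [card_copies_two_three hr.left_pair hE, evalList]
  next =>
    cases hE : isComplete 3 2 E with
    | false => simp [hE] at hp
    | true =>
      obtain rfl : [] = p := by simpa [hE] using hp
      rw [isComplete_iff] at hE
      rw [← card_copies_flip, card_copies_two_three (r := flip r) hr.right_pair]
      · simp [evalList]
      · rw [isComplete_iff]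
        exact fun i hi j hj ↦ by simpa using hE j hj i hi
  next => simp at hp

theorem findLast_lt {P : ℕ → Bool} {b j : ℕ} (h : findLast P b = some j) : j < b := by
  induction b with
  | zero => simp [findLast] at h
  | succ b ih =>
    cases hP : P b <;> simp only [findLast, hP, cond_true, cond_false, Option.some.injEq] at h
    · exact (ih h).trans (Nat.lt_succ_self b)
    · omega

end

theorem copyValue_eq {α β : Type*} [Fintype α] [Fintype β] {r : α → β → Prop} {t : ℕ}
    (hr : IsAdmissible r t) {k a b : ℕ} {E : List (ℕ × ℕ)} {p : List ℤ}
    (hp : copyValue k a b E = some p) : ((copies r a b E).card : ℤ) = evalList t p := by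
  have H : ∀ (k : ℕ) (a b : ℕ) (E : List (ℕ × ℕ)) (p : List ℤ),
      copyValue k a b E = some p → ((copies r a b E).card : ℤ) = evalList t p ∧
        ((copies (flip r) a b E).card : ℤ) = evalList t p := by
    intro k
    induction k with
    | zero => simp [copyValue]
    | succ k ih =>
      intro a b E p hp
      simp only [copyValue] at hp
      split at hp
      next j hj =>
        have hjb := findLast_lt hj
        obtain ⟨b, rfl⟩ : ∃ c, b = c + 1 := ⟨b - 1, by omega⟩
        rw [← card_copies_swapRight r hjb, ← card_copies_swapRight (flip r) hjb]
        exact ⟨lastValue_eq hr (fun E p h ↦ (ih _ _ _ _ h).1) hp,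
          lastValue_eq hr.flip (fun E p h ↦ (ih _ _ _ _ h).2) hp⟩
      next =>
        split at hp
        next =>
          have := ih _ _ _ _ hp
          rw [card_copies_flip] at this
          rw [← card_copies_flip (flip r)]
          exact this.symm
        next => exact ⟨coreValue_eq hr hp, coreValue_eq hr.flip hp⟩
  exact (H k a b E p hp).1

theorem copyValue_six :
    copyValue 30 6 6 [(0, 0), (1, 1), (2, 2), (3, 3), (4, 4), (5, 5)] =
      some [-6480, 88632, -303426, 492075, -360855, -177147, 531441] := by
  decide +kernel

section
variable {V W : Type*} {G : SimpleGraph V}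

theorem card_copy_eq [Finite V] [Finite W] (X : SimpleGraph W) :
    Nat.card (X.Copy G) = numSubgraphs G X * Nat.card (X ≃g X) := by
  have : Fintype {H : G.Subgraph // Nonempty (H.coe ≃g X)} := Fintype.ofFinite _
  have (H : G.Subgraph) : Finite (X ≃g H.coe) := Finite.of_injective _ DFunLike.coe_injective
  let F : (Σ H : {H : G.Subgraph // Nonempty (H.coe ≃g X)}, X ≃g H.1.coe) → X.Copy G :=
    fun q ↦ q.1.1.coeCopy.comp q.2.toCopy
  have hF (q) : (F q).toSubgraph = q.1.1 := by
    obtain ⟨⟨H, hH⟩, e⟩ := q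
    ext u v
    · simp only [Copy.toSubgraph, Subgraph.map_verts, Subgraph.verts_top, Set.image_univ]
      constructor
      · rintro ⟨w, rfl⟩
        exact (e w).2
      · exact fun hu ↦ ⟨e.symm ⟨u, hu⟩, congrArg Subtype.val (e.apply_symm_apply ⟨u, hu⟩)⟩
    · simp only [Copy.toSubgraph, Subgraph.map_adj, Relation.Map, Subgraph.top_adj]
      constructor
      · rintro ⟨w, w', h, rfl, rfl⟩
        exact e.map_adj_iff.2 h
      · intro h
        refine ⟨e.symm ⟨u, H.edge_vert h⟩, e.symm ⟨v, H.edge_vert h.symm⟩, ?_,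
          congrArg Subtype.val (e.apply_symm_apply _), congrArg Subtype.val (e.apply_symm_apply _)⟩
        exact e.symm.map_adj_iff.2 h
  have hbij : F.Bijective := by
    constructor
    · rintro ⟨⟨H, hH⟩, e⟩ ⟨⟨H', hH'⟩, e'⟩ h
      obtain rfl : H = H' := (hF ⟨⟨H, hH⟩, e⟩).symm.trans (h ▸ hF ⟨⟨H', hH'⟩, e'⟩)
      congr 1
      ext w
      exact congrArg (fun f : X.Copy G ↦ f w) h
    · intro f
      refine ⟨⟨⟨f.toSubgraph, ⟨f.isoToSubgraph.symm⟩⟩, f.isoToSubgraph⟩, ?_⟩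
      ext w
      rfl
  rw [← Nat.card_congr (Equiv.ofBijective F hbij), Nat.card_sigma]
  have (H : {H : G.Subgraph // Nonempty (H.coe ≃g X)}) :
      Nat.card (X ≃g H.1.coe) = Nat.card (X ≃g X) := by
    obtain ⟨e⟩ := H.2
    exact Nat.card_congr ⟨fun f ↦ f.trans e, fun f ↦ f.trans e.symm,
      fun f ↦ by ext; simp, fun f ↦ by ext; simp⟩
  rw [Finset.sum_congr rfl fun H _ ↦ this H, Finset.sum_const, smul_eq_mul, numSubgraphs,
    ← Nat.card_coe_set_eq, Finset.card_univ, ← Nat.card_eq_fintype_card]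
  rfl

/-- Adjacency in `G` between the two color classes. -/
def ColorAdj (C : G.Coloring (Fin 2)) (x : {v // C v = 0}) (y : {v // C v = 1}) : Prop :=
  G.Adj x y

theorem color_eq_one_iff (C : G.Coloring (Fin 2)) {u v : V} (h : G.Adj u v) :
    C v = 1 ↔ C u = 0 := by
  have := C.valid h
  omega

theorem color_eq_zero_iff (C : G.Coloring (Fin 2)) {u v : V} (h : G.Adj u v) :
    C v = 0 ↔ C u = 1 := (color_eq_one_iff C h.symm).symm

theorem card_copy_eq_two_mul [Finite V] [Finite W] (C : G.Coloring (Fin 2)) {X : SimpleGraph W}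
    (ρ : X ≃g X) {w : W} (hw : X.Adj w (ρ w)) :
    Nat.card (X.Copy G) = 2 * Nat.card {f : X.Copy G // C (f w) = 0} := by
  have h1 : Nat.card {f : X.Copy G // ¬ C (f w) = 0} = Nat.card {f : X.Copy G // C (f w) = 0} := by
    refine Nat.card_congr (Equiv.subtypeEquiv
      ⟨fun f ↦ f.comp ρ.toCopy, fun f ↦ f.comp ρ.symm.toCopy, fun f ↦ ?_, fun f ↦ ?_⟩ fun f ↦ ?_)
    · ext; simp
    · ext; simp
    · have := color_eq_zero_iff C (f.toHom.map_adj hw)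
      simp only [Copy.toHom_apply] at this
      simp [this]
      omega
  classical
  have : Finite (X.Copy G) := Finite.of_injective _ DFunLike.coe_injective
  rw [← Nat.card_congr (Equiv.sumCompl fun f : X.Copy G ↦ C (f w) = 0), Nat.card_sum, h1, two_mul]

theorem card_copy_colored [Fintype V] (C : G.Coloring (Fin 2)) {X : SimpleGraph W} {w : W}
    {a b : ℕ} (e : Fin a ⊕ Fin b ≃ W) {E : List (ℕ × ℕ)}
    (hE : ∀ (i : Fin a) (j : Fin b), X.Adj (e (.inl i)) (e (.inr j)) ↔ ((i : ℕ), (j : ℕ)) ∈ E)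
    (hl : ∀ i i', ¬ X.Adj (e (.inl i)) (e (.inl i')))
    (hr : ∀ j j', ¬ X.Adj (e (.inr j)) (e (.inr j')))
    (hC : ∀ f : X.Copy G, C (f w) = 0 ↔
      (∀ i, C (f (e (.inl i))) = 0) ∧ ∀ j, C (f (e (.inr j))) = 1) :
    Nat.card {f : X.Copy G // C (f w) = 0} = (copies (ColorAdj C) a b E).card := by
  have F : {f : X.Copy G // C (f w) = 0} ≃ {p // p ∈ copies (ColorAdj C) a b E} :=
    { toFun f := ⟨(fun i ↦ ⟨f.1 (e (.inl i)), ((hC f.1).1 f.2).1 i⟩,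
          fun j ↦ ⟨f.1 (e (.inr j)), ((hC f.1).1 f.2).2 j⟩),
        mem_copies.2 ⟨fun i i' h ↦ by simpa using f.1.injective (congrArg Subtype.val h),
          fun j j' h ↦ by simpa using f.1.injective (congrArg Subtype.val h),
          fun i j hij ↦ f.1.toHom.map_adj ((hE i j).2 hij)⟩⟩
      invFun p := by
        have h1 := (mem_copies.1 p.2).1
        have h2 := (mem_copies.1 p.2).2.1
        have h3 := (mem_copies.1 p.2).2.2
        let φ : Fin a ⊕ Fin b → V := Sum.elim (fun i ↦ p.1.1 i) fun j ↦ p.1.2 j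
        have hφ : φ.Injective := by
          refine (Subtype.val_injective.comp h1).sumElim (Subtype.val_injective.comp h2)
            fun i j h ↦ ?_
          have h4 := (p.1.1 i).2
          have h5 := (p.1.2 j).2
          simp only [Function.comp_apply] at h
          rw [h, h5] at h4
          exact absurd h4 (by decide)
        have hadj : ∀ x y, X.Adj (e x) (e y) → G.Adj (φ x) (φ y) := by
          rintro (i | j) (i' | j') h
          · exact absurd h (hl _ _)
          · exact h3 i j' ((hE _ _).1 h)
          · exact (h3 i' j ((hE _ _).1 h.symm)).symm
          · exact absurd h (hr _ _)
        let f : X.Copy G := ⟨⟨φ ∘ e.symm, fun {x y} h ↦ hadj _ _ (by simpa using h)⟩,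
          hφ.comp e.symm.injective⟩
        refine ⟨f, (hC f).2 ⟨fun i ↦ ?_, fun j ↦ ?_⟩⟩
        · simpa [f, φ] using (p.1.1 i).2
        · simpa [f, φ] using (p.1.2 j).2
      left_inv f := by
        ext x
        obtain ⟨x | x, rfl⟩ := e.surjective x <;> simp
      right_inv p := by
        ext x <;> simp }
  rw [Nat.card_congr F, Nat.card_eq_fintype_card, Fintype.card_coe]
end

theorem numMatchings_eq {V : Type*} [Fintype V] {G : SimpleGraph V} (C : G.Coloring (Fin 2))
    {k : ℕ} {E : List (ℕ × ℕ)} (hE : ∀ i < k, ∀ j < k, (i, j) ∈ E ↔ i = j) :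
    (copies (ColorAdj C) k k E).card = numMatchings G k * k.factorial := by
  have hend : ∀ e : G.edgeSet, ∃ q : {v // C v = 0} × {v // C v = 1},
      (e : Sym2 V) = s((q.1 : V), (q.2 : V)) := by
    rintro ⟨e, he⟩
    induction e using Sym2.ind with
    | _ u v =>
      have := color_eq_one_iff C he
      by_cases hu : C u = 0
      · exact ⟨(⟨u, hu⟩, ⟨v, this.2 hu⟩), rfl⟩
      · have hu1 : C u = 1 := Fin.eq_one_of_ne_zero _ hu
        exact ⟨(⟨v, (color_eq_zero_iff C he).2 hu1⟩, ⟨u, hu1⟩), Sym2.eq_swap⟩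
  choose ends hends using hend
  have huniq : ∀ (x x' : {v // C v = 0}) (y y' : {v // C v = 1}),
      s((x : V), (y : V)) = s((x' : V), (y' : V)) → x = x' ∧ y = y' := by
    intro x x' y y' h
    rw [Sym2.eq_iff] at h
    obtain ⟨h1, h2⟩ | ⟨h1, h2⟩ := h
    · exact ⟨Subtype.ext h1, Subtype.ext h2⟩
    · have h3 := x.2
      rw [h1, y'.2] at h3
      exact absurd h3 (by decide)
  let M := {H : G.Subgraph // H.IsMatching ∧ H.edgeSet.ncard = k}
  have : Fintype M := Fintype.ofFinite _
  let endsOf (H : M) (e : H.1.edgeSet) := ends ⟨e, H.1.edgeSet_subset e.2⟩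
  have hendsOf (H : M) (e : H.1.edgeSet) :
      H.1.Adj (endsOf H e).1 (endsOf H e).2 := by
    rw [← Subgraph.mem_edgeSet, ← hends]
    exact e.2
  let F : (Σ H : M, Fin k ≃ H.1.edgeSet) → {p // p ∈ copies (ColorAdj C) k k E} := fun q ↦
    ⟨(fun i ↦ (endsOf q.1 (q.2 i)).1, fun i ↦ (endsOf q.1 (q.2 i)).2), by
      obtain ⟨H, e⟩ := q
      refine mem_copies.2 ⟨fun i j h ↦ ?_, fun i j h ↦ ?_, fun i j hij ↦ ?_⟩
      · refine e.injective (Subtype.ext ?_)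
        have h1 := hendsOf H (e i)
        have h2 := hendsOf H (e j)
        dsimp only at h
        rw [← h] at h2
        rw [hends ⟨e i, _⟩, hends ⟨e j, _⟩]
        change s(((endsOf H (e i)).1 : V), ((endsOf H (e i)).2 : V)) =
          s(((endsOf H (e j)).1 : V), ((endsOf H (e j)).2 : V))
        rw [← h, H.2.1.eq_of_adj_left h1 h2]
      · refine e.injective (Subtype.ext ?_)
        have h1 := hendsOf H (e i)
        have h2 := hendsOf H (e j)
        dsimp only at h
        rw [← h] at h2
        rw [hends ⟨e i, _⟩, hends ⟨e j, _⟩]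
        change s(((endsOf H (e i)).1 : V), ((endsOf H (e i)).2 : V)) =
          s(((endsOf H (e j)).1 : V), ((endsOf H (e j)).2 : V))
        rw [← h, H.2.1.eq_of_adj_right h1 h2]
      · obtain rfl : i = j := Fin.ext ((hE i i.2 j j.2).1 hij)
        exact (hendsOf H (e i)).adj_sub⟩
  have hF (q) (i : Fin k) : (q.2 i : Sym2 V) = s(((F q).1.1 i : V), ((F q).1.2 i : V)) :=
    hends ⟨q.2 i, _⟩
  have hbij : F.Bijective := by
    constructor
    · intro q q' h
      have h1 (i) : (q.2 i : Sym2 V) = q'.2 i := by rw [hF, hF, h]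
      obtain ⟨⟨H, hH⟩, e⟩ := q
      obtain ⟨⟨H', hH'⟩, e'⟩ := q'
      obtain rfl : H = H' := by
        refine Subgraph.IsMatching.injOn_edgeSet hH.1 hH'.1
          (Set.ext fun d ↦ ⟨fun hd ↦ ?_, fun hd ↦ ?_⟩)
        · obtain ⟨i, hi⟩ := e.surjective ⟨d, hd⟩
          have := h1 i
          simp only [hi] at this
          rw [this]
          exact (e' i).2
        · obtain ⟨i, hi⟩ := e'.surjective ⟨d, hd⟩
          have := h1 i
          simp only [hi] at this
          rw [← this]
          exact (e i).2
      congr 1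
      exact Equiv.ext fun i ↦ Subtype.ext (h1 i)
    · rintro ⟨⟨f, g⟩, hp⟩
      obtain ⟨h1, h2, h3⟩ := mem_copies.1 hp
      have hfg (i j) : (f i : V) ≠ g j := fun h ↦ by
        have h4 := (f i).2
        rw [h, (g j).2] at h4
        exact absurd h4 (by decide)
      have hf (i j) : (f i : V) = f j ↔ i = j := by rw [Subtype.val_inj, h1.eq_iff]
      have hg (i j) : (g i : V) = g j ↔ i = j := by rw [Subtype.val_inj, h2.eq_iff]
      let H : G.Subgraph :=
        { verts := {v | ∃ i, v = f i ∨ v = g i}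
          Adj u v := ∃ i, (u = f i ∧ v = g i) ∨ (u = g i ∧ v = f i)
          adj_sub := by
            rintro u v ⟨i, ⟨rfl, rfl⟩ | ⟨rfl, rfl⟩⟩
            · exact h3 i i ((hE i i.2 i i.2).2 rfl)
            · exact (h3 i i ((hE i i.2 i i.2).2 rfl)).symm
          edge_vert := by
            rintro u v ⟨i, h | h⟩
            · exact ⟨i, .inl h.1⟩
            · exact ⟨i, .inr h.1⟩
          symm := ⟨by
            rintro u v ⟨i, h⟩
            exact ⟨i, h.symm.imp And.symm And.symm⟩⟩ }
      have hedge (d : Sym2 V) : d ∈ H.edgeSet ↔ ∃ i, s((f i : V), (g i : V)) = d := by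
        induction d using Sym2.ind with
        | _ u v =>
          simp only [Subgraph.mem_edgeSet, H, Sym2.eq_iff]
          refine exists_congr fun i ↦ ?_
          simp only [eq_comm]
          tauto
      let e : Fin k ≃ H.edgeSet := Equiv.ofBijective
        (fun i ↦ ⟨s((f i : V), (g i : V)), (hedge _).2 ⟨i, rfl⟩⟩)
        ⟨fun i j h ↦ h1 (huniq _ _ _ _ (congrArg Subtype.val h)).1, fun ⟨d, hd⟩ ↦ by
          obtain ⟨i, hi⟩ := (hedge d).1 hd
          exact ⟨i, Subtype.ext hi⟩⟩
      have hH : H.IsMatching := by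
        rintro v ⟨i, rfl | rfl⟩
        · refine ⟨g i, ⟨i, .inl ⟨rfl, rfl⟩⟩, ?_⟩
          rintro _ ⟨j, ⟨h, rfl⟩ | ⟨h, rfl⟩⟩
          · rw [(hf i j).1 h]
          · exact absurd h (hfg i j)
        · refine ⟨f i, ⟨i, .inr ⟨rfl, rfl⟩⟩, ?_⟩
          rintro _ ⟨j, ⟨h, rfl⟩ | ⟨h, rfl⟩⟩
          · exact absurd h.symm (hfg j i)
          · rw [(hg i j).1 h]
      have hcard : H.edgeSet.ncard = k := by
        rw [← Nat.card_coe_set_eq, ← Nat.card_congr e, Nat.card_fin]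
      refine ⟨⟨⟨H, hH, hcard⟩, e⟩, ?_⟩
      have h4 (i) := huniq _ _ _ _ (hF ⟨⟨H, hH, hcard⟩, e⟩ i)
      ext i
      · exact congrArg Subtype.val (h4 i).1.symm
      · exact congrArg Subtype.val (h4 i).2.symm
  have hfac (H : M) : Nat.card (Fin k ≃ H.1.edgeSet) = k.factorial := by
    have e : H.1.edgeSet ≃ Fin k :=
      Finite.equivFinOfCardEq (by rw [Nat.card_coe_set_eq, H.2.2])
    rw [Nat.card_congr (Equiv.equivCongr (Equiv.refl _) e), Nat.card_perm, Nat.card_fin]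
  have h := Nat.card_congr (Equiv.ofBijective F hbij)
  rw [Nat.card_sigma, Finset.sum_congr rfl fun H _ ↦ hfac H, Finset.sum_const, smul_eq_mul,
    Nat.card_eq_fintype_card, Fintype.card_coe, Finset.card_univ, ← Nat.card_eq_fintype_card] at h
  rw [← h, numMatchings, ← Nat.card_coe_set_eq]
  rfl

theorem card_cycleGraph_four_iso : Nat.card (cycleGraph 4 ≃g cycleGraph 4) = 8 := by
  have e : (cycleGraph 4 ≃g cycleGraph 4) ≃
    {σ : Equiv.Perm (Fin 4) // ∀ i j, (cycleGraph 4).Adj (σ i) (σ j) ↔ (cycleGraph 4).Adj i j} :=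
    ⟨fun f ↦ ⟨f.toEquiv, fun i j ↦ f.map_adj_iff⟩, fun σ ↦ ⟨σ.1, σ.2 _ _⟩, fun _ ↦ rfl, fun _ ↦ rfl⟩
  rw [Nat.card_congr e, Nat.card_eq_fintype_card]
  decide +kernel

theorem card_cycleGraph_six_iso : Nat.card (cycleGraph 6 ≃g cycleGraph 6) = 12 := by
  have e : (cycleGraph 6 ≃g cycleGraph 6) ≃
    {σ : Equiv.Perm (Fin 6) // ∀ i j, (cycleGraph 6).Adj (σ i) (σ j) ↔ (cycleGraph 6).Adj i j} :=
    ⟨fun f ↦ ⟨f.toEquiv, fun i j ↦ f.map_adj_iff⟩, fun σ ↦ ⟨σ.1, σ.2 _ _⟩, fun _ ↦ rfl, fun _ ↦ rfl⟩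
  rw [Nat.card_congr e, Nat.card_eq_fintype_card]
  decide +kernel

/-- Separates the even from the odd vertices of the 4-cycle. -/
def splitFour : Fin 2 ⊕ Fin 2 ≃ Fin 4 where
  toFun := Sum.elim ![0, 2] ![1, 3]
  invFun := ![.inl 0, .inr 0, .inl 1, .inr 1]
  left_inv := by decide
  right_inv := by decide

/-- Separates the even from the odd vertices of the 6-cycle, matching opposite vertices. -/
def splitSix : Fin 3 ⊕ Fin 3 ≃ Fin 6 where
  toFun := Sum.elim ![0, 2, 4] ![3, 5, 1]
  invFun := ![.inl 0, .inr 2, .inl 1, .inr 0, .inl 2, .inr 1]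
  left_inv := by decide
  right_inv := by decide

theorem ncard_setOf_subtype {V : Type*} {P Q : V → Prop} (h : ∀ v, Q v → P v) :
    {x : {v // P v} | Q x}.ncard = {v | Q v}.ncard := by
  rw [← Set.ncard_image_of_injective _ Subtype.val_injective]
  congr 1
  ext v
  simpa using h v

section
variable {V : Type*} [Fintype V] {G : SimpleGraph V} (C : G.Coloring (Fin 2))

theorem card_copies_four :
    (copies (ColorAdj C) 2 2 [(0, 0), (0, 1), (1, 1), (1, 0)]).card =
      4 * numSubgraphs G (cycleGraph 4) := by
  have h := card_copy_eq_two_mul (G := G) C (X := cycleGraph 4)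
    ⟨Equiv.addRight 1, by decide +revert⟩ (w := 0) (by decide)
  rw [card_copy_eq, card_cycleGraph_four_iso, card_copy_colored C splitFour
    (E := [(0, 0), (0, 1), (1, 1), (1, 0)]) (by decide) (by decide) (by decide)] at h
  · omega
  · intro f
    have h1 := color_eq_one_iff C (f.toHom.map_adj (show (cycleGraph 4).Adj 0 1 by decide))
    have h2 := color_eq_zero_iff C (f.toHom.map_adj (show (cycleGraph 4).Adj 1 2 by decide))
    have h3 := color_eq_one_iff C (f.toHom.map_adj (show (cycleGraph 4).Adj 2 3 by decide))
    simp only [Copy.toHom_apply] at h1 h2 h3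
    simp [Fin.forall_fin_succ, splitFour]
    tauto

theorem card_copies_six :
    (copies (ColorAdj C) 3 3 [(0, 1), (0, 2), (1, 2), (1, 0), (2, 0), (2, 1)]).card =
      6 * numSubgraphs G (cycleGraph 6) := by
  have h := card_copy_eq_two_mul (G := G) C (X := cycleGraph 6)
    ⟨Equiv.addRight 1, by decide +revert⟩ (w := 0) (by decide)
  rw [card_copy_eq, card_cycleGraph_six_iso, card_copy_colored C splitSix
    (E := [(0, 1), (0, 2), (1, 2), (1, 0), (2, 0), (2, 1)])
    (by decide) (by decide) (by decide)] at h
  · omega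
  · intro f
    have h1 := color_eq_one_iff C (f.toHom.map_adj (show (cycleGraph 6).Adj 0 1 by decide))
    have h2 := color_eq_zero_iff C (f.toHom.map_adj (show (cycleGraph 6).Adj 1 2 by decide))
    have h3 := color_eq_one_iff C (f.toHom.map_adj (show (cycleGraph 6).Adj 2 3 by decide))
    have h4 := color_eq_zero_iff C (f.toHom.map_adj (show (cycleGraph 6).Adj 3 4 by decide))
    have h5 := color_eq_one_iff C (f.toHom.map_adj (show (cycleGraph 6).Adj 4 5 by decide))
    simp only [Copy.toHom_apply] at h1 h2 h3 h4 h5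
    simp [Fin.forall_fin_succ, splitSix]
    tauto

theorem degree_color_zero [DecidableRel G.Adj] (hG : G.IsRegularOfDegree 3)
    (x : {v // C v = 0}) : {y | ColorAdj C x y}.ncard = 3 := by
  have := ncard_setOf_subtype (P := fun v ↦ C v = 1) (Q := fun v ↦ G.Adj x v)
    fun v h ↦ (color_eq_one_iff C h).2 x.2
  rw [← hG x, ← card_neighborFinset_eq_degree, ← Set.ncard_coe_finset, coe_neighborFinset]
  exact this

theorem degree_color_one [DecidableRel G.Adj] (hG : G.IsRegularOfDegree 3)
    (y : {v // C v = 1}) : {x | ColorAdj C x y}.ncard = 3 := by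
  have := ncard_setOf_subtype (P := fun v ↦ C v = 0) (Q := fun v ↦ G.Adj y v)
    fun v h ↦ (color_eq_zero_iff C h).2 y.2
  rw [← hG y, ← card_neighborFinset_eq_degree, ← Set.ncard_coe_finset, coe_neighborFinset]
  exact (congrArg Set.ncard (Set.ext fun x ↦ G.adj_comm _ _)).trans this

theorem card_color_zero_eq_card_color_one [DecidableRel G.Adj] (hG : G.IsRegularOfDegree 3) :
    Fintype.card {v // C v = 0} = Fintype.card {v // C v = 1} := by
  classical
  have h := Finset.sum_card_bipartiteAbove_eq_sum_card_bipartiteBelow (ColorAdj C)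
    (s := Finset.univ) (t := Finset.univ)
  have h0 (x) : (Finset.univ.bipartiteAbove (ColorAdj C) x).card = 3 := by
    rw [← degree_color_zero C hG x, ← Set.ncard_coe_finset]
    simp [Finset.bipartiteAbove]
  have h1 (y) : (Finset.univ.bipartiteBelow (ColorAdj C) y).card = 3 := by
    rw [← degree_color_one C hG y, ← Set.ncard_coe_finset]
    simp [Finset.bipartiteBelow]
  simpa [h0, h1] using h

theorem card_color_zero_add_card_color_one :
    Fintype.card {v // C v = 0} + Fintype.card {v // C v = 1} = Fintype.card V := by
  have h : Fintype.card {v // ¬ C v = 0} = Fintype.card {v // C v = 1} :=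
    Fintype.card_congr (Equiv.subtypeEquivRight fun v ↦ by omega)
  rw [← h, ← Fintype.card_sum, Fintype.card_congr (Equiv.sumCompl fun v ↦ C v = 0)]
end

theorem ncard_common_neighbors_le {V : Type*} [Finite V] {G : SimpleGraph V}
    (hG : ∀ H₁ H₂ : G.Subgraph, Nonempty (H₁.coe ≃g cycleGraph 4) →
      Nonempty (H₂.coe ≃g cycleGraph 4) → H₁ ≠ H₂ →
      (H₁.edgeSet ∩ H₂.edgeSet).ncard ≤ 1) {x₁ x₂ : V} (hx : x₁ ≠ x₂) :
    {y | G.Adj x₁ y ∧ G.Adj x₂ y}.ncard ≤ 2 := by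
  by_contra! h
  obtain ⟨y₁, y₂, y₃, h1, h2, h3, h12, h13, h23⟩ := (Set.two_lt_ncard_iff (Set.toFinite _)).1 h
  have mk (y y' : V) (hy : G.Adj x₁ y ∧ G.Adj x₂ y) (hy' : G.Adj x₁ y' ∧ G.Adj x₂ y')
      (hne : y ≠ y') : ∃ H : G.Subgraph, Nonempty (H.coe ≃g cycleGraph 4) ∧
        s(x₁, y) ∈ H.edgeSet ∧ s(x₂, y) ∈ H.edgeSet ∧ H.verts = {x₁, y, x₂, y'} := by
    have hs : ∀ i : Fin 4, G.Adj (![x₁, y, x₂, y'] i) (![x₁, y, x₂, y'] (i + 1)) := by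
      simp [Fin.forall_fin_succ, hy.1, hy.2.symm, hy'.1.symm, hy'.2]
    have hadj (i j : Fin 4) (h : (cycleGraph 4).Adj i j) :
        G.Adj (![x₁, y, x₂, y'] i) (![x₁, y, x₂, y'] j) := by
      obtain rfl | rfl : j = i + 1 ∨ i = j + 1 := by
        revert i j
        decide
      · exact hs i
      · exact (hs j).symm
    have hinj : Function.Injective ![x₁, y, x₂, y'] := by
      simp [Function.Injective, Fin.forall_fin_succ, hx, hne, hy.1.ne, hy.2.ne, hy'.1.ne,
        hy'.2.ne, hx.symm, hne.symm, hy.1.ne', hy.2.ne', hy'.1.ne', hy'.2.ne']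
    let f : (cycleGraph 4).Copy G := ⟨⟨![x₁, y, x₂, y'], hadj _ _⟩, hinj⟩
    refine ⟨f.toSubgraph, ⟨f.isoToSubgraph.symm⟩, ?_, ?_, ?_⟩
    · exact ⟨0, 1, show (cycleGraph 4).Adj 0 1 by decide, rfl, rfl⟩
    · exact ⟨2, 1, show (cycleGraph 4).Adj 2 1 by decide, rfl, rfl⟩
    · simp only [Copy.toSubgraph, Subgraph.map_verts, Subgraph.verts_top, Set.image_univ]
      ext v
      simp [f, eq_comm]
      tauto
  obtain ⟨H, hH, he, he', hv⟩ := mk y₁ y₂ h1 h2 h12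
  obtain ⟨K, hK, ke, ke', kv⟩ := mk y₁ y₃ h1 h3 h13
  have hne : H ≠ K := by
    rintro rfl
    have : y₂ ∈ ({x₁, y₁, x₂, y₂} : Set V) := by simp
    rw [← hv, kv] at this
    simp [h2.1.ne', h2.2.ne', h12.symm, h23] at this
  have hlt : 1 < (H.edgeSet ∩ K.edgeSet).ncard := by
    refine (Set.one_lt_ncard_iff (Set.toFinite _)).2
      ⟨s(x₁, y₁), s(x₂, y₁), ⟨he, ke⟩, ⟨he', ke'⟩, fun h ↦ hx ?_⟩
    exact Sym2.congr_left.1 h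
  exact (hG H K hH hK hne).not_gt hlt

theorem isAdmissible_colorAdj {V : Type*} [Fintype V] {G : SimpleGraph V} [DecidableRel G.Adj]
    (C : G.Coloring (Fin 2)) (hreg : G.IsRegularOfDegree 3) {t : ℕ}
    (hcard : Fintype.card V = 6 * t + 8) (hfour : numSubgraphs G (cycleGraph 4) = 6)
    (hshare : ∀ H₁ H₂ : G.Subgraph, Nonempty (H₁.coe ≃g cycleGraph 4) →
      Nonempty (H₂.coe ≃g cycleGraph 4) → H₁ ≠ H₂ →
      (H₁.edgeSet ∩ H₂.edgeSet).ncard ≤ 1)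
    (hsix : numSubgraphs G (cycleGraph 6) = 4 * t + 7) : IsAdmissible (ColorAdj C) t where
  card_left := by
    have h1 := card_color_zero_eq_card_color_one C hreg
    have h2 := card_color_zero_add_card_color_one C
    omega
  card_right := by
    have h1 := card_color_zero_eq_card_color_one C hreg
    have h2 := card_color_zero_add_card_color_one C
    omega
  degree_left := degree_color_zero C hreg
  degree_right := degree_color_one C hreg
  four_cycles := by rw [card_copies_four, hfour]
  six_cycles := by rw [card_copies_six, hsix]
  left_pair x₁ x₂ h := by
    have h1 := ncard_common_neighbors_le hshare (Subtype.coe_ne_coe.2 h)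
    rwa [← ncard_setOf_subtype fun v hv ↦ (color_eq_one_iff C hv.1).2 x₁.2] at h1
  right_pair y₁ y₂ h := by
    have h1 := ncard_common_neighbors_le hshare (Subtype.coe_ne_coe.2 h)
    rw [← ncard_setOf_subtype fun v hv ↦ (color_eq_zero_iff C hv.1).2 y₁.2] at h1
    simpa only [ColorAdj, G.adj_comm] using h1

end CopyCount

theorem stmt_18 {V : Type*} [Fintype V] [DecidableEq V] (G : SimpleGraph V) [DecidableRel G.Adj]
    (hreg : G.IsRegularOfDegree 3) (hbip : G.Colorable 2) (t : ℕ) (ht : 1 ≤ t)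
    (hcard : Fintype.card V = 6 * t + 8)
    (hsix : numSubgraphs G (cycleGraph 4) = 6)
    (hshare : ∀ H₁ H₂ : G.Subgraph, Nonempty (H₁.coe ≃g cycleGraph 4) →
      Nonempty (H₂.coe ≃g cycleGraph 4) → H₁ ≠ H₂ →
      (H₁.edgeSet ∩ H₂.edgeSet).ncard ≤ 1)
    (hsixcycles : numSubgraphs G (cycleGraph 6) = 4 * t + 7) :
    (240 * numMatchings G 6 : ℤ) =
      243 * (3 * (t : ℤ)) ^ 6 - 243 * (3 * (t : ℤ)) ^ 5 - 1485 * (3 * (t : ℤ)) ^ 4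
        + 6075 * (3 * (t : ℤ)) ^ 3 - 11238 * (3 * (t : ℤ)) ^ 2 + 9848 * (3 * (t : ℤ)) - 2160 := by
  obtain ⟨C⟩ := hbip
  have h := CopyCount.copyValue_eq
    (CopyCount.isAdmissible_colorAdj C hreg hcard hsix hshare hsixcycles) CopyCount.copyValue_six
  rw [CopyCount.numMatchings_eq C (by decide)] at h
  simp only [CopyCount.evalList, Nat.factorial] at h
  push_cast at h
  linarith
end
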